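/- Let p > 1 and q ∈ L^1(0,1) be 1-periodic. Suppose the spectrum of the anti-periodic eigenvalue problem -( (y')^{(p-1)} )' = (p-1)(λ - q) y^{(p-1)}, y(0) = -y(1), y'(0) = -y'(1) contains { ((2n-1)π̂)^p : n ∈ N }, that π̂^p is the least eigenvalue, and that ∫_0^1 q(t) (S_p(π̂ t) S_p'(π̂ t)^{(p-1)})' dt = 0. Then q = 0 almost everywhere on [0,1]. -/

import Mathlib

open MeasureTheory Real Set Filter intervalIntegral
open scoped Topology

/-- The signed power `f^{(r)} = |f|^r sgn f`. -/
noncomputable def sgnPow (r x : ℝ) : ℝ := |x| ^ r * Real.sign x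

/-- The generalized half-period `π̂ = 2π/(p sin(π/p))`. -/
noncomputable def pihat (p : ℝ) : ℝ := 2 * Real.pi / (p * Real.sin (Real.pi / p))

/-- `lam` is an eigenvalue of the anti-periodic `p`-Laplacian
`-((y')^{(p-1)})' = (p-1)(λ - q) y^{(p-1)}`, `y(0) = -y(1)`, `y'(0) = -y'(1)`,
with the equation understood in the integrated (Carathéodory) sense. -/
def IsAntiPeriodicEig (p : ℝ) (q : ℝ → ℝ) (lam : ℝ) : Prop :=
  ∃ y : ℝ → ℝ, Differentiable ℝ y ∧ (∃ x, y x ≠ 0) ∧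
    (∀ a b : ℝ, sgnPow (p - 1) (deriv y b) - sgnPow (p - 1) (deriv y a) =
      -∫ t in a..b, (p - 1) * (lam - q t) * sgnPow (p - 1) (y t)) ∧
    y 0 = -y 1 ∧ deriv y 0 = -deriv y 1

/-! ### Locally absolutely continuous functions -/

/-- `f` is locally absolutely continuous with derivative `f'` almost everywhere. -/
structure ACDeriv (f f' : ℝ → ℝ) : Prop where
  ac : ∀ a b : ℝ, AbsolutelyContinuousOnInterval f a b
  ae_deriv : ∀ᵐ x : ℝ, HasDerivAt f (f' x) x

theorem LipschitzOnWith.comp_absolutelyContinuousOnInterval {f F : ℝ → ℝ} {a b : ℝ}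
    {K : NNReal} {s : Set ℝ} (hF : LipschitzOnWith K F s)
    (hf : AbsolutelyContinuousOnInterval f a b) (hs : MapsTo f (uIcc a b) s) :
    AbsolutelyContinuousOnInterval (fun x => F (f x)) a b := by
  rw [absolutelyContinuousOnInterval_iff] at hf ⊢
  intro ε hε
  obtain ⟨δ, hδ, h⟩ := hf (ε / (K + 1)) (by positivity)
  refine ⟨δ, hδ, fun E hE hlt => ?_⟩
  have h1 := h E hE hlt
  have hK : (0:ℝ) ≤ K := K.2
  calc ∑ i ∈ Finset.range E.1, dist (F (f (E.2 i).1)) (F (f (E.2 i).2))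
      ≤ ∑ i ∈ Finset.range E.1, K * dist (f (E.2 i).1) (f (E.2 i).2) := by
        apply Finset.sum_le_sum
        intro i hi
        exact hF.dist_le_mul _ (hs (hE.1 i hi).1) _ (hs (hE.1 i hi).2)
    _ = K * ∑ i ∈ Finset.range E.1, dist (f (E.2 i).1) (f (E.2 i).2) :=
        (Finset.mul_sum _ _ _).symm
    _ ≤ K * (ε / (K + 1)) := by gcongr
    _ < (K + 1) * (ε / (K + 1)) := by gcongr; linarith
    _ = ε := by field

theorem AbsolutelyContinuousOnInterval.comp_of_continuousOn_deriv {f F F' : ℝ → ℝ} {a b : ℝ}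
    {U : Set ℝ} (hF : ∀ x ∈ U, HasDerivAt F (F' x) x) (hF' : ContinuousOn F' U)
    (hf : AbsolutelyContinuousOnInterval f a b) (hs : MapsTo f (uIcc a b) U) :
    AbsolutelyContinuousOnInterval (fun x => F (f x)) a b := by
  have hcpt : IsCompact (f '' uIcc a b) := isCompact_uIcc.image_of_continuousOn hf.continuousOn
  have hconv : Convex ℝ (f '' uIcc a b) :=
    ((isPreconnected_uIcc.image f hf.continuousOn).ordConnected).convex
  have hsub : f '' uIcc a b ⊆ U := hs.image_subset
  obtain ⟨C, hC⟩ := hcpt.exists_bound_of_continuousOn (hF'.mono hsub)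
  have hL : LipschitzOnWith (Real.toNNReal C) F (f '' uIcc a b) := by
    refine hconv.lipschitzOnWith_of_nnnorm_hasDerivWithin_le (f' := F')
      (fun x hx => (hF x (hsub hx)).hasDerivWithinAt) fun x hx => ?_
    exact NNReal.coe_le_coe.1 ((hC x hx).trans (Real.le_coe_toNNReal C))
  exact hL.comp_absolutelyContinuousOnInterval hf (mapsTo_image _ _)

namespace ACDeriv

variable {f f' g g' : ℝ → ℝ}

theorem continuous (h : ACDeriv f f') : Continuous f := by
  rw [continuous_iff_continuousAt]
  intro x
  have := (h.ac (x - 1) (x + 1)).continuousOn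
  rw [uIcc_of_le (by linarith)] at this
  exact this.continuousAt (Icc_mem_nhds (by linarith) (by linarith))

theorem intervalIntegrable (h : ACDeriv f f') (a b : ℝ) :
    IntervalIntegrable f' volume a b := by
  refine (h.ac a b).intervalIntegrable_deriv.congr_ae (ae_restrict_of_ae ?_)
  filter_upwards [h.ae_deriv] with x hx using hx.deriv

theorem integral_eq_sub (h : ACDeriv f f') (a b : ℝ) : ∫ x in a..b, f' x = f b - f a := by
  rw [← (h.ac a b).integral_deriv_eq_sub]
  apply intervalIntegral.integral_congr_ae
  filter_upwards [h.ae_deriv] with x hx _ using hx.deriv.symm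

theorem eq_add_integral (h : ACDeriv f f') (t : ℝ) : f t = f 0 + ∫ x in (0:ℝ)..t, f' x := by
  rw [h.integral_eq_sub]; ring

theorem congr (h : ACDeriv f f') (hf : ∀ x, f x = g x) (hg : ∀ x, f' x = g' x) :
    ACDeriv g g' := by
  obtain rfl : f = g := funext hf
  obtain rfl : f' = g' := funext hg
  exact h

theorem of_integral (hi : ∀ a b, IntervalIntegrable f' volume a b)
    (h : ∀ a b, f b - f a = ∫ x in a..b, f' x) : ACDeriv f f' := by
  have hfun : f = fun x => f 0 + ∫ v in (0:ℝ)..x, f' v := by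
    funext x; rw [← h]; ring
  have hloc : LocallyIntegrable f' volume := by
    intro x
    refine ⟨Icc (x - 1) (x + 1), Icc_mem_nhds (by linarith) (by linarith), ?_⟩
    exact (intervalIntegrable_iff_integrableOn_Icc_of_le (by linarith)).1 (hi _ _)
  refine ⟨fun a b => ?_, ?_⟩
  · have h1 := (hi a b).absolutelyContinuousOnInterval_intervalIntegral (c := a) left_mem_uIcc
    have h2 : AbsolutelyContinuousOnInterval (fun _ : ℝ => f a) a b :=
      (LipschitzWith.const (f a)).lipschitzOnWith (s := uIcc a b)
        |>.absolutelyContinuousOnInterval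
    have h3 := h2.fun_add h1
    have h4 : (fun x => f a + ∫ v in a..x, f' v) = f := by
      funext x; rw [← h]; ring
    rwa [h4] at h3
  · filter_upwards [LocallyIntegrable.ae_hasDerivAt_integral hloc] with x hx
    rw [hfun]
    exact (hx 0).const_add (f 0)

theorem integral (hi : ∀ a b, IntervalIntegrable f' volume a b) (c : ℝ) :
    ACDeriv (fun t => ∫ x in c..t, f' x) f' :=
  of_integral hi fun a b => by
    rw [sub_eq_iff_eq_add']
    exact (intervalIntegral.integral_add_adjacent_intervals (hi c a) (hi a b)).symm

theorem of_hasDerivAt (h : ∀ x, HasDerivAt f (f' x) x) (hc : Continuous f') : ACDeriv f f' :=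
  of_integral (fun a b => hc.intervalIntegrable a b) fun a b =>
    (intervalIntegral.integral_eq_sub_of_hasDerivAt (fun x _ => h x)
      (hc.intervalIntegrable a b)).symm

theorem hasDerivAt (h : ACDeriv f f') (hc : Continuous f') (x : ℝ) : HasDerivAt f (f' x) x := by
  have : f = fun t => f 0 + ∫ v in (0:ℝ)..t, f' v := funext h.eq_add_integral
  rw [this]
  exact (hc.integral_hasStrictDerivAt 0 x).hasDerivAt.const_add _

theorem const (c : ℝ) : ACDeriv (fun _ => c) (fun _ => 0) :=
  of_hasDerivAt (fun x => hasDerivAt_const x c) continuous_const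

theorem add (hf : ACDeriv f f') (hg : ACDeriv g g') :
    ACDeriv (fun x => f x + g x) (fun x => f' x + g' x) :=
  ⟨fun a b => (hf.ac a b).fun_add (hg.ac a b), by
    filter_upwards [hf.ae_deriv, hg.ae_deriv] with x h1 h2 using h1.add h2⟩

theorem sub (hf : ACDeriv f f') (hg : ACDeriv g g') :
    ACDeriv (fun x => f x - g x) (fun x => f' x - g' x) :=
  ⟨fun a b => (hf.ac a b).fun_sub (hg.ac a b), by
    filter_upwards [hf.ae_deriv, hg.ae_deriv] with x h1 h2 using h1.sub h2⟩

theorem mul (hf : ACDeriv f f') (hg : ACDeriv g g') :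
    ACDeriv (fun x => f x * g x) (fun x => f' x * g x + f x * g' x) :=
  ⟨fun a b => (hf.ac a b).fun_mul (hg.ac a b), by
    filter_upwards [hf.ae_deriv, hg.ae_deriv] with x h1 h2 using h1.mul h2⟩

theorem const_mul (c : ℝ) (hf : ACDeriv f f') :
    ACDeriv (fun x => c * f x) (fun x => c * f' x) :=
  ((const c).mul hf).congr (fun _ => rfl) fun x => by ring

theorem comp {F F' : ℝ → ℝ} (hF : ∀ x, HasDerivAt F (F' x) x) (hF' : Continuous F')
    (hf : ACDeriv f f') : ACDeriv (fun x => F (f x)) (fun x => F' (f x) * f' x) :=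
  ⟨fun a b => (hf.ac a b).comp_of_continuousOn_deriv (U := univ) (fun x _ => hF x)
      hF'.continuousOn (mapsTo_univ _ _), by
    filter_upwards [hf.ae_deriv] with x h1 using (hF (f x)).comp x h1⟩

theorem exp (hf : ACDeriv f f') :
    ACDeriv (fun x => Real.exp (f x)) (fun x => Real.exp (f x) * f' x) :=
  hf.comp Real.hasDerivAt_exp Real.continuous_exp

/-- Variation of constants for a scalar linear equation with locally integrable coefficients. -/
theorem linear_eq {c k : ℝ → ℝ} (hc : ∀ a b, IntervalIntegrable c volume a b)
    (h : ACDeriv f (fun x => c x * f x + k x)) (t : ℝ) :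
    f t = Real.exp (∫ x in (0:ℝ)..t, c x) *
      (f 0 + ∫ s in (0:ℝ)..t, Real.exp (-∫ x in (0:ℝ)..s, c x) * k s) := by
  have h1 := ((integral hc 0).const_mul (-1)).exp.mul h
  have h2 := (h1.congr (g' := fun s => Real.exp (-∫ x in (0:ℝ)..s, c x) * k s)
    (fun _ => rfl) (fun s => by rw [neg_one_mul]; ring)).eq_add_integral t
  simp only [intervalIntegral.integral_same, mul_zero, Real.exp_zero, one_mul, neg_one_mul] at h2
  rw [← h2, ← mul_assoc, ← Real.exp_add]
  simp

theorem linear_homogeneous_eq {c : ℝ → ℝ} (hc : ∀ a b, IntervalIntegrable c volume a b)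
    (h : ACDeriv f (fun x => c x * f x)) (t : ℝ) :
    f t = f 0 * Real.exp (∫ x in (0:ℝ)..t, c x) := by
  have := (h.congr (g' := fun x => c x * f x + 0) (fun _ => rfl) (fun x => by ring)).linear_eq hc t
  simpa [mul_comm] using this

end ACDeriv

/-! ### Signed powers -/

theorem sgnPow_zero (r : ℝ) : sgnPow r 0 = 0 := by simp [sgnPow]

theorem sgnPow_of_pos {x : ℝ} (r : ℝ) (hx : 0 < x) : sgnPow r x = x ^ r := by
  simp [sgnPow, abs_of_pos hx, Real.sign_of_pos hx]

theorem sgnPow_neg (r x : ℝ) : sgnPow r (-x) = -sgnPow r x := by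
  simp [sgnPow, Real.sign_neg]

theorem sgnPow_pos_iff (r : ℝ) {x : ℝ} : 0 < sgnPow r x ↔ 0 < x := by
  rcases lt_trichotomy x 0 with h1 | rfl | h1
  · have := sgnPow_of_pos r (neg_pos.2 h1)
    rw [sgnPow_neg] at this
    have h2 := Real.rpow_pos_of_pos (neg_pos.2 h1) r
    constructor <;> intro <;> linarith
  · rw [sgnPow_zero]
  · simp [h1, sgnPow_of_pos _ h1, Real.rpow_pos_of_pos h1]

theorem sgnPow_neg_iff (r : ℝ) {x : ℝ} : sgnPow r x < 0 ↔ x < 0 := by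
  rw [← neg_pos, ← sgnPow_neg, sgnPow_pos_iff, neg_pos]

theorem sgnPow_of_nonneg {r x : ℝ} (hr : r ≠ 0) (hx : 0 ≤ x) : sgnPow r x = x ^ r := by
  rcases hx.eq_or_lt with rfl | hx
  · rw [sgnPow_zero, Real.zero_rpow hr]
  · exact sgnPow_of_pos r hx

theorem sgnPow_one (x : ℝ) : sgnPow 1 x = x := by
  rcases lt_trichotomy x 0 with h | rfl | h
  · simp [sgnPow, abs_of_neg h, Real.sign_of_neg h]
  · exact sgnPow_zero 1
  · simp [sgnPow_of_pos 1 h]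

theorem sgnPow_mul (r x y : ℝ) : sgnPow r (x * y) = sgnPow r x * sgnPow r y := by
  have : Real.sign (x * y) = Real.sign x * Real.sign y := by
    rcases lt_trichotomy x 0 with hx | rfl | hx <;> rcases lt_trichotomy y 0 with hy | rfl | hy <;>
      simp [Real.sign_of_pos, Real.sign_of_neg, mul_pos_of_neg_of_neg, mul_neg_of_neg_of_pos,
        mul_neg_of_pos_of_neg, *]
  rw [sgnPow, sgnPow, sgnPow, abs_mul, Real.mul_rpow (abs_nonneg _) (abs_nonneg _), this]
  ring

theorem abs_sgnPow {r : ℝ} (hr : r ≠ 0) (x : ℝ) : |sgnPow r x| = |x| ^ r := by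
  rcases lt_trichotomy x 0 with h | rfl | h
  · simp [sgnPow, Real.sign_of_neg h, abs_of_nonneg (Real.rpow_nonneg (abs_nonneg x) r)]
  · simp [sgnPow, Real.zero_rpow hr]
  · simp [sgnPow, Real.sign_of_pos h, abs_of_nonneg (Real.rpow_nonneg (abs_nonneg x) r)]

theorem sgnPow_sgnPow (r s x : ℝ) : sgnPow s (sgnPow r x) = sgnPow (r * s) x := by
  have key : ∀ x : ℝ, 0 < x → sgnPow s (sgnPow r x) = sgnPow (r * s) x := fun x h => by
    rw [sgnPow_of_pos r h, sgnPow_of_pos s (Real.rpow_pos_of_pos h r), sgnPow_of_pos _ h,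
      Real.rpow_mul h.le]
  rcases lt_trichotomy x 0 with h | rfl | h
  · have := key (-x) (by linarith)
    simpa [sgnPow_neg] using this
  · simp [sgnPow_zero]
  · exact key x h

theorem sgnPow_leftInverse {r : ℝ} (hr : r ≠ 0) (x : ℝ) : sgnPow (1 / r) (sgnPow r x) = x := by
  rw [sgnPow_sgnPow, mul_one_div_cancel hr, sgnPow_one]

theorem sgnPow_injective {r : ℝ} (hr : r ≠ 0) : Function.Injective (sgnPow r) :=
  Function.LeftInverse.injective (sgnPow_leftInverse hr)

theorem sgnPow_mul_self {p : ℝ} (hp : p ≠ 0) (x : ℝ) : sgnPow (p - 1) x * x = |x| ^ p := by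
  rcases lt_trichotomy x 0 with h | rfl | h
  · rw [sgnPow, Real.sign_of_neg h, Real.rpow_sub_one (abs_pos.2 h.ne).ne', abs_of_neg h]
    have := h.ne
    field_simp
  · simp [Real.zero_rpow hp]
  · rw [sgnPow_of_pos _ h, abs_of_pos h, Real.rpow_sub_one h.ne']
    field_simp

theorem self_mul_sgnPow {p : ℝ} (hp : p ≠ 0) (x : ℝ) : x * sgnPow (p - 1) x = |x| ^ p := by
  rw [mul_comm, sgnPow_mul_self hp]

theorem continuous_sgnPow {r : ℝ} (hr : 0 < r) : Continuous (sgnPow r) := by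
  have h : ∀ x : ℝ, sgnPow r x = (max x 0) ^ r - (max (-x) 0) ^ r := fun x => by
    rcases le_total 0 x with hx | hx
    · simp [sgnPow_of_nonneg hr.ne' hx, max_eq_left hx, max_eq_right (neg_nonpos.2 hx),
        Real.zero_rpow hr.ne']
    · have h1 := sgnPow_of_nonneg hr.ne' (neg_nonneg.2 hx)
      rw [sgnPow_neg] at h1
      simp [max_eq_right hx, max_eq_left (neg_nonneg.2 hx), Real.zero_rpow hr.ne', ← h1]
  rw [funext h]
  exact ((continuous_id.max continuous_const).rpow_const fun _ => Or.inr hr.le).sub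
    ((continuous_id.neg.max continuous_const).rpow_const fun _ => Or.inr hr.le)

theorem hasDerivAt_abs_rpow_sgnPow {p : ℝ} (hp : 1 < p) (x : ℝ) :
    HasDerivAt (fun x : ℝ => |x| ^ p) (p * sgnPow (p - 1) x) x := by
  convert hasDerivAt_abs_rpow x hp using 1
  rcases lt_trichotomy x 0 with h | rfl | h
  · rw [sgnPow, Real.sign_of_neg h, show p - 1 = (p - 2) + 1 by ring,
      Real.rpow_add_one (abs_pos.2 h.ne).ne', abs_of_neg h]
    ring
  · simp [sgnPow_zero]
  · rw [sgnPow_of_pos _ h, show p - 1 = (p - 2) + 1 by ring, Real.rpow_add_one h.ne',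
      abs_of_pos h]
    ring

theorem continuous_abs_rpow {p : ℝ} (hp : 0 ≤ p) : Continuous fun x : ℝ => |x| ^ p :=
  continuous_abs.rpow_const fun _ => Or.inr hp

/-- The tangent line inequality for `|x| ^ p`, with its equality case. -/
theorem abs_rpow_tangent {p : ℝ} (hp : 1 < p) (a c : ℝ) :
    0 ≤ |a| ^ p + (p - 1) * |c| ^ p - p * a * sgnPow (p - 1) c ∧
      (|a| ^ p + (p - 1) * |c| ^ p - p * a * sgnPow (p - 1) c = 0 → a = c) := by
  have hsc : StrictMono (sgnPow (p - 1)) := by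
    refine (continuous_sgnPow (by linarith)).strictMono_of_inj
      (sgnPow_injective (by linarith)) |>.resolve_right fun h => ?_
    have := h (zero_lt_one)
    rw [sgnPow_zero, sgnPow_of_pos _ one_pos, Real.one_rpow] at this
    linarith
  have hD : ∀ x, HasDerivAt (fun x : ℝ => |x| ^ p - p * x * sgnPow (p - 1) c)
      (p * (sgnPow (p - 1) x - sgnPow (p - 1) c)) x := fun x => by
    refine ((hasDerivAt_abs_rpow_sgnPow hp x).sub
      (((hasDerivAt_id x).const_mul p).mul_const (sgnPow (p - 1) c))).congr_deriv ?_
    ring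
  have hcont : Continuous (fun x : ℝ => |x| ^ p - p * x * sgnPow (p - 1) c) :=
    continuous_iff_continuousAt.2 fun x => (hD x).continuousAt
  have h0 : |c| ^ p - p * c * sgnPow (p - 1) c = -((p - 1) * |c| ^ p) := by
    rw [mul_assoc, self_mul_sgnPow (by linarith)]; ring
  have hlt : a ≠ c → |c| ^ p - p * c * sgnPow (p - 1) c < |a| ^ p - p * a * sgnPow (p - 1) c := by
    intro hne
    rcases lt_or_gt_of_ne hne with h | h
    · refine strictAntiOn_of_deriv_neg (convex_Iic c) hcont.continuousOn (fun x hx => ?_)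
        h.le (le_refl c) h
      rw [interior_Iic] at hx
      rw [(hD x).deriv]
      nlinarith [hsc hx]
    · refine strictMonoOn_of_deriv_pos (convex_Ici c) hcont.continuousOn (fun x hx => ?_)
        (le_refl c) h.le h
      rw [interior_Ici] at hx
      rw [(hD x).deriv]
      have := hsc hx
      have : 0 < sgnPow (p - 1) x - sgnPow (p - 1) c := by linarith
      positivity
  constructor
  · by_cases h : a = c
    · subst h; linarith
    · linarith [hlt h]
  · intro h
    by_contra hne
    linarith [hlt hne]

/-! ### The generalized sine function -/

/-- `S` is the generalized sine function of exponent `p`, and `C` its derivative. -/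
structure GenSine (p : ℝ) (S C : ℝ → ℝ) : Prop where
  one_lt : 1 < p
  hasDerivAt : ∀ x, HasDerivAt S (C x) x
  continuous_deriv : Continuous C
  hasDerivAt_sgnPow : ∀ x,
    HasDerivAt (fun t => sgnPow (p - 1) (C t)) (-((p - 1) * sgnPow (p - 1) (S x))) x
  pythagoras : ∀ x, |S x| ^ p + |C x| ^ p = 1
  map_zero : S 0 = 0
  deriv_zero : C 0 = 1

theorem GenSine.of_hasDerivAt_mul {p : ℝ} (hp : 1 < p) {S : ℝ → ℝ} (hS : Differentiable ℝ S)
    (hS0 : S 0 = 0) (hS'0 : deriv S 0 = 1)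
    (hSprod : ∀ x : ℝ, HasDerivAt (fun t => S t * sgnPow (p - 1) (deriv S t))
      (1 - p * |S x| ^ p) x)
    (hpyth : ∀ x : ℝ, |S x| ^ p + |deriv S x| ^ p = 1) : GenSine p S (deriv S) := by
  have hp0 : p ≠ 0 := by linarith
  have hp1 : p - 1 ≠ 0 := by linarith
  have hne : ∀ x, S x ≠ 0 → HasDerivAt (fun t => sgnPow (p - 1) (deriv S t))
      (-((p - 1) * sgnPow (p - 1) (S x))) x := fun x hx => by
    have h1 := (hSprod x).div (hS x).hasDerivAt hx
    have h2 : (fun t => S t * sgnPow (p - 1) (deriv S t)) / S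
        =ᶠ[𝓝 x] fun t => sgnPow (p - 1) (deriv S t) := by
      filter_upwards [(hS x).continuousAt.eventually_ne hx] with t ht
      simp only [Pi.div_apply]
      field_simp
    refine (h1.congr_of_eventuallyEq h2.symm).congr_deriv ?_
    have h3 := sgnPow_mul_self hp0 (deriv S x)
    have h4 := sgnPow_mul_self hp0 (S x)
    have h5 := hpyth x
    rw [div_eq_iff (by positivity)]
    have h6 : |deriv S x| ^ p = 1 - |S x| ^ p := by linarith
    have h7 : S x * sgnPow (p - 1) (deriv S x) * deriv S x = S x * (1 - |S x| ^ p) := by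
      rw [← h6, ← h3]; ring
    rw [h7]
    have h8 : sgnPow (p - 1) (S x) * S x ^ 2 = |S x| ^ p * S x := by rw [← h4]; ring
    linear_combination (p - 1) * h8
  have hcont : ∀ x, ContinuousAt (fun t => sgnPow (p - 1) (deriv S t)) x := fun x => by
    by_cases hx : S x = 0
    · have hd : |deriv S x| = 1 := by
        have := hpyth x
        rw [hx, abs_zero, Real.zero_rpow hp0, zero_add] at this
        exact (Real.rpow_left_inj (abs_nonneg _) zero_le_one hp0).1
          (this.trans (Real.one_rpow p).symm)
      have hd0 : deriv S x ≠ 0 := by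
        intro h; rw [h] at hd; simp at hd
      have h1 := hasDerivAt_iff_tendsto_slope.1 (hSprod x)
      have h2 := hasDerivAt_iff_tendsto_slope.1 (hS x).hasDerivAt
      have h3 := h1.div h2 hd0
      rw [continuousAt_iff_punctured_nhds]
      have hval : (1 - p * |S x| ^ p) / deriv S x = sgnPow (p - 1) (deriv S x) := by
        rw [hx, abs_zero, Real.zero_rpow hp0, sgnPow, hd, Real.one_rpow]
        rcases abs_eq (zero_le_one) |>.1 hd with h | h
        · simp [h]
        · rw [h, Real.sign_of_neg (by norm_num)]; norm_num
      rw [hval] at h3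
      refine h3.congr' ?_
      have hev : ∀ᶠ t in 𝓝[≠] x, slope S x t ≠ 0 := h2.eventually_ne hd0
      filter_upwards [hev, self_mem_nhdsWithin] with t ht htx
      simp only [Pi.div_apply, slope_def_field, hx, sub_zero, zero_mul] at ht ⊢
      have hSt : S t ≠ 0 := fun h => ht (by simp [h])
      have htx' : t - x ≠ 0 := sub_ne_zero.2 htx
      field_simp
    · exact (hne x hx).continuousAt
  have hSc : Continuous S := hS.continuous
  refine ⟨hp, fun x => (hS x).hasDerivAt, ?_, fun x => ?_, hpyth, hS0, hS'0⟩
  · have : deriv S = fun t => sgnPow (1 / (p - 1)) (sgnPow (p - 1) (deriv S t)) :=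
      funext fun t => (sgnPow_leftInverse hp1 _).symm
    rw [this]
    exact (continuous_sgnPow (by rw [one_div]; exact inv_pos.2 (by linarith))).comp
      (continuous_iff_continuousAt.2 hcont)
  · by_cases hx : S x = 0
    · have hd0 : deriv S x ≠ 0 := by
        intro h
        have := hpyth x
        simp [hx, h, Real.zero_rpow hp0] at this
      have hev := (hS x).hasDerivAt.eventually_ne (c := 0) hd0
      rw [eventually_nhdsWithin_iff] at hev
      obtain ⟨ε, hε, hball⟩ := Metric.eventually_nhds_iff_ball.1 hev
      have hloc : ∀ t ∈ Metric.ball x ε, t ≠ x →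
          HasDerivAt (fun t => sgnPow (p - 1) (deriv S t)) (-((p - 1) * sgnPow (p - 1) (S t))) t :=
        fun t ht htx => hne t (hball t ht htx)
      have hg : Continuous fun t => -((p - 1) * sgnPow (p - 1) (S t)) :=
        (continuous_const.mul ((continuous_sgnPow (by linarith)).comp hSc)).neg
      have hA : HasDerivWithinAt (fun t => sgnPow (p - 1) (deriv S t))
          (-((p - 1) * sgnPow (p - 1) (S x))) (Ici x) x := by
        have hmem : ∀ t ∈ Ioo x (x + ε), t ∈ Metric.ball x ε ∧ t ≠ x := fun t ht => by
          rw [Real.ball_eq_Ioo]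
          exact ⟨⟨by linarith [ht.1], ht.2⟩, ht.1.ne'⟩
        refine hasDerivWithinAt_Ici_of_tendsto_deriv (s := Ioo x (x + ε)) (fun t ht =>
          (hloc t (hmem t ht).1 (hmem t ht).2).differentiableAt.differentiableWithinAt)
          (hcont x).continuousWithinAt (Ioo_mem_nhdsGT (by linarith)) ?_
        refine (tendsto_inf_left (hg.tendsto x)).congr' ?_
        filter_upwards [Ioo_mem_nhdsGT (show x < x + ε by linarith)] with t ht
        exact (hloc t (hmem t ht).1 (hmem t ht).2).deriv.symm
      have hB : HasDerivWithinAt (fun t => sgnPow (p - 1) (deriv S t))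
          (-((p - 1) * sgnPow (p - 1) (S x))) (Iic x) x := by
        have hmem : ∀ t ∈ Ioo (x - ε) x, t ∈ Metric.ball x ε ∧ t ≠ x := fun t ht => by
          rw [Real.ball_eq_Ioo]
          exact ⟨⟨ht.1, by linarith [ht.2]⟩, ht.2.ne⟩
        refine hasDerivWithinAt_Iic_of_tendsto_deriv (s := Ioo (x - ε) x) (fun t ht =>
          (hloc t (hmem t ht).1 (hmem t ht).2).differentiableAt.differentiableWithinAt)
          (hcont x).continuousWithinAt (Ioo_mem_nhdsLT (by linarith)) ?_
        refine (tendsto_inf_left (hg.tendsto x)).congr' ?_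
        filter_upwards [Ioo_mem_nhdsLT (show x - ε < x by linarith)] with t ht
        exact (hloc t (hmem t ht).1 (hmem t ht).2).deriv.symm
      simpa using hB.union hA
    · exact hne x hx

/-! ### Polar angles -/

/-- A continuous choice of polar angle along a locally absolutely continuous plane curve. -/
theorem ACDeriv.eq_mul_sin_cos {Y Y' Z Z' m β : ℝ → ℝ} (hY : ACDeriv Y Y') (hZ : ACDeriv Z Z')
    (hpos : ∀ t, Y t ≠ 0 ∨ Z t ≠ 0) (hβ : ACDeriv β m)
    (hm : ∀ t, m t = (Z t * Y' t - Y t * Z' t) / (Y t ^ 2 + Z t ^ 2)) {N : ℝ} (hN : 0 < N)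
    (hY0 : Y 0 = N * Real.sin (β 0)) (hZ0 : Z 0 = N * Real.cos (β 0)) (t : ℝ) :
    ∃ N : ℝ, 0 < N ∧ Y t = N * Real.sin (β t) ∧ Z t = N * Real.cos (β t) := by
  have hR : ∀ t, 0 < Y t ^ 2 + Z t ^ 2 := fun t => by
    rcases hpos t with h | h <;> positivity
  have hc := hβ.comp Real.hasDerivAt_cos Real.continuous_sin.neg
  have hs := hβ.comp Real.hasDerivAt_sin Real.continuous_cos
  set s : ℝ → ℝ := fun t => (Y t * Y' t + Z t * Z' t) * (Y t ^ 2 + Z t ^ 2)⁻¹ with hs_def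
  have hsi : ∀ a b, IntervalIntegrable s volume a b := fun a b => by
    refine IntervalIntegrable.mul_continuousOn (g := fun t => (Y t ^ 2 + Z t ^ 2)⁻¹) ?_ ?_
    · exact ((hY.intervalIntegrable a b).continuousOn_mul hY.continuous.continuousOn).add
        ((hZ.intervalIntegrable a b).continuousOn_mul hZ.continuous.continuousOn)
    · exact (((hY.continuous.pow 2).add (hZ.continuous.pow 2)).inv₀
        fun t => (hR t).ne').continuousOn
  have e1 : ∀ t, Y' t = s t * Y t + m t * Z t := fun t => by
    have := (hR t).ne'
    rw [hm, hs_def]; field_simp; ring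
  have e2 : ∀ t, Z' t = s t * Z t - m t * Y t := fun t => by
    have := (hR t).ne'
    rw [hm, hs_def]; field_simp; ring
  have hD : ∀ t, Y t * Real.cos (β t) - Z t * Real.sin (β t) = 0 := fun t => by
    have h1 := ((hY.mul hc).sub (hZ.mul hs)).congr
      (g' := fun t => s t * (Y t * Real.cos (β t) - Z t * Real.sin (β t))) (fun _ => rfl)
      (fun t => by rw [e1, e2]; ring)
    rw [h1.linear_homogeneous_eq hsi t, hY0, hZ0]
    ring
  have hNd := ((hY.mul hs).add (hZ.mul hc)).congr
      (g' := fun t => s t * (Y t * Real.sin (β t) + Z t * Real.cos (β t))) (fun _ => rfl)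
      (fun t => by rw [e1, e2]; ring)
  refine ⟨Y t * Real.sin (β t) + Z t * Real.cos (β t), ?_, ?_, ?_⟩
  · rw [hNd.linear_homogeneous_eq hsi t, hY0, hZ0]
    have := Real.sin_sq_add_cos_sq (β 0)
    have : N * Real.sin (β 0) * Real.sin (β 0) + N * Real.cos (β 0) * Real.cos (β 0) = N := by
      linear_combination N * this
    rw [this]
    positivity
  · have := Real.sin_sq_add_cos_sq (β t)
    linear_combination Real.cos (β t) * hD t - Y t * this
  · have := Real.sin_sq_add_cos_sq (β t)
    linear_combination -Real.sin (β t) * hD t - Z t * this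

theorem exists_eq_mul_sin_cos {a z : ℝ} (h : a ≠ 0 ∨ z ≠ 0) :
    ∃ N β : ℝ, 0 < N ∧ a = N * Real.sin β ∧ z = N * Real.cos β := by
  refine ⟨‖(⟨z, a⟩ : ℂ)‖, Complex.arg ⟨z, a⟩, ?_, ?_, ?_⟩
  · rw [norm_pos_iff]
    intro h0
    have h1 := congrArg Complex.re h0
    have h2 := congrArg Complex.im h0
    simp at h1 h2
    rcases h with h | h
    · exact h h2
    · exact h h1
  · rw [Complex.norm_mul_sin_arg]
  · rw [Complex.norm_mul_cos_arg]

/-- A ray from the origin meets a convex curve `|a| ^ r + |z| ^ s = 1` at most once. -/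
theorem eq_one_of_abs_rpow_add_abs_rpow {r s : ℝ} (hr : 0 < r) (hs : 0 < s) {a z N : ℝ}
    (hN : 0 < N) (h1 : |a| ^ r + |z| ^ s = 1) (h2 : |N * a| ^ r + |N * z| ^ s = 1) : N = 1 := by
  rw [abs_mul, abs_mul, Real.mul_rpow (abs_nonneg _) (abs_nonneg _),
    Real.mul_rpow (abs_nonneg _) (abs_nonneg _), abs_of_pos hN] at h2
  have ha := Real.rpow_nonneg (abs_nonneg a) r
  have hz := Real.rpow_nonneg (abs_nonneg z) s
  rcases lt_trichotomy N 1 with h | h | h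
  · have i1 := Real.rpow_lt_one hN.le h hr
    have i2 := Real.rpow_lt_one hN.le h hs
    rcases ha.eq_or_lt with h0 | h0
    · nlinarith
    · nlinarith [mul_le_mul_of_nonneg_right i2.le hz, mul_lt_mul_of_pos_right i1 h0]
  · exact h
  · have i1 := Real.one_lt_rpow h hr
    have i2 := Real.one_lt_rpow h hs
    rcases ha.eq_or_lt with h0 | h0
    · nlinarith
    · nlinarith [mul_le_mul_of_nonneg_right i2.le hz, mul_lt_mul_of_pos_right i1 h0]

namespace GenSine

variable {p : ℝ} {S C : ℝ → ℝ}

theorem pos (h : GenSine p S C) : 0 < p := by linarith [h.one_lt]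

theorem sub_one_pos (h : GenSine p S C) : 0 < p - 1 := by linarith [h.one_lt]

theorem continuous (h : GenSine p S C) : Continuous S :=
  continuous_iff_continuousAt.2 fun x => (h.hasDerivAt x).continuousAt

theorem continuous_conj (h : GenSine p S C) : Continuous fun t => sgnPow (p - 1) (C t) :=
  continuous_iff_continuousAt.2 fun x => (h.hasDerivAt_sgnPow x).continuousAt

theorem acDeriv (h : GenSine p S C) : ACDeriv S C :=
  .of_hasDerivAt h.hasDerivAt h.continuous_deriv

theorem continuous_conj_deriv (h : GenSine p S C) :
    Continuous fun x => -((p - 1) * sgnPow (p - 1) (S x)) :=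
  (continuous_const.mul ((continuous_sgnPow h.sub_one_pos).comp h.continuous)).neg

theorem acDeriv_conj (h : GenSine p S C) : ACDeriv (fun t => sgnPow (p - 1) (C t))
    (fun x => -((p - 1) * sgnPow (p - 1) (S x))) :=
  .of_hasDerivAt h.hasDerivAt_sgnPow h.continuous_conj_deriv

theorem abs_rpow_le_one (h : GenSine p S C) (x : ℝ) : |S x| ^ p ≤ 1 := by
  have := Real.rpow_nonneg (abs_nonneg (C x)) p
  linarith [h.pythagoras x]

theorem abs_le_one (h : GenSine p S C) (x : ℝ) : |S x| ≤ 1 := by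
  by_contra! hlt
  have := Real.one_lt_rpow hlt h.pos
  linarith [h.abs_rpow_le_one x]

theorem abs_deriv_le_one (h : GenSine p S C) (x : ℝ) : |C x| ≤ 1 := by
  by_contra! hlt
  have := Real.one_lt_rpow hlt h.pos
  have := Real.rpow_nonneg (abs_nonneg (S x)) p
  linarith [h.pythagoras x]

theorem abs_conj_le_one (h : GenSine p S C) (x : ℝ) : |sgnPow (p - 1) (C x)| ≤ 1 := by
  rw [abs_sgnPow h.sub_one_pos.ne']
  exact Real.rpow_le_one (abs_nonneg _) (h.abs_deriv_le_one x) h.sub_one_pos.le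

theorem abs_sgnPow_le_one (h : GenSine p S C) (x : ℝ) : |sgnPow (p - 1) (S x)| ≤ 1 := by
  rw [abs_sgnPow h.sub_one_pos.ne']
  exact Real.rpow_le_one (abs_nonneg _) (h.abs_le_one x) h.sub_one_pos.le

theorem ne_zero_or (h : GenSine p S C) (x : ℝ) : S x ≠ 0 ∨ sgnPow (p - 1) (C x) ≠ 0 := by
  by_contra! hx
  have h1 : C x = 0 := sgnPow_injective h.sub_one_pos.ne' (hx.2.trans (sgnPow_zero _).symm)
  have := h.pythagoras x
  simp [h1, hx.1, Real.zero_rpow h.pos.ne'] at this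

/-- Angular speed of the curve traced by a generalized sine and its conjugate. -/
noncomputable def speed (p : ℝ) (S C : ℝ → ℝ) (x : ℝ) : ℝ :=
  (|C x| ^ p + (p - 1) * |S x| ^ p) / (S x ^ 2 + sgnPow (p - 1) (C x) ^ 2)

theorem denom_pos (h : GenSine p S C) (x : ℝ) : 0 < S x ^ 2 + sgnPow (p - 1) (C x) ^ 2 := by
  rcases h.ne_zero_or x with h | h <;> positivity

theorem continuous_speed (h : GenSine p S C) : Continuous (speed p S C) := by
  refine Continuous.div ?_ ((h.continuous.pow 2).add (h.continuous_conj.pow 2))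
    fun x => (h.denom_pos x).ne'
  exact ((continuous_abs_rpow h.pos.le).comp h.continuous_deriv).add
    (continuous_const.mul ((continuous_abs_rpow h.pos.le).comp h.continuous))

theorem min_le_speed (h : GenSine p S C) (x : ℝ) : min 1 (p - 1) / 2 ≤ speed p S C x := by
  have h1 : S x ^ 2 ≤ 1 := (sq_le_one_iff_abs_le_one _).2 (h.abs_le_one x)
  have h2 : sgnPow (p - 1) (C x) ^ 2 ≤ 1 := (sq_le_one_iff_abs_le_one _).2 (h.abs_conj_le_one x)
  have h3 := h.denom_pos x
  have h4 := h.pythagoras x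
  have h5 := Real.rpow_nonneg (abs_nonneg (C x)) p
  have h6 := Real.rpow_nonneg (abs_nonneg (S x)) p
  have h7 : min 1 (p - 1) ≤ |C x| ^ p + (p - 1) * |S x| ^ p := by
    nlinarith [min_le_left 1 (p - 1), min_le_right 1 (p - 1)]
  have h8 : 0 < min 1 (p - 1) := lt_min one_pos h.sub_one_pos
  rw [speed, div_le_div_iff₀ two_pos h3]
  nlinarith

theorem speed_pos (h : GenSine p S C) (x : ℝ) : 0 < speed p S C x :=
  lt_of_lt_of_le (half_pos (lt_min one_pos h.sub_one_pos)) (h.min_le_speed x)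

theorem exists_angle (h : GenSine p S C) : ∃ A B : ℝ → ℝ, A 0 = 0 ∧ StrictMono A ∧
    (∀ x, A (B x) = x) ∧ (∀ x, B (A x) = x) ∧ (∀ x, HasDerivAt A (speed p S C x) x) ∧
    (∀ x, HasDerivAt B (speed p S C (B x))⁻¹ x) ∧
    ∀ x, ∃ N : ℝ, 0 < N ∧ S x = N * Real.sin (A x) ∧
      sgnPow (p - 1) (C x) = N * Real.cos (A x) := by
  set A : ℝ → ℝ := fun x => ∫ t in (0:ℝ)..x, speed p S C t with hA
  have hAd : ∀ x, HasDerivAt A (speed p S C x) x := fun x =>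
    (h.continuous_speed.integral_hasStrictDerivAt 0 x).hasDerivAt
  have hA0 : A 0 = 0 := intervalIntegral.integral_same
  have hmono : StrictMono A := strictMono_of_hasDerivAt_pos hAd h.speed_pos
  have hcont : Continuous A := continuous_iff_continuousAt.2 fun x => (hAd x).continuousAt
  set k := min 1 (p - 1) / 2
  have hk : 0 < k := half_pos (lt_min one_pos h.sub_one_pos)
  have hmono2 : Monotone fun x => A x - k * x := by
    refine monotone_of_hasDerivAt_nonneg (f' := fun x => speed p S C x - k) (fun x => ?_)
      fun x => sub_nonneg.2 (h.min_le_speed x)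
    exact ((hAd x).sub ((hasDerivAt_id x).const_mul k)).congr_deriv (by ring)
  have htop : Tendsto A atTop atTop := by
    refine tendsto_atTop_mono' _ ?_ ((tendsto_id (α := ℝ)).const_mul_atTop hk)
    filter_upwards [eventually_ge_atTop 0] with x hx
    have := hmono2 hx
    simp only [hA0, mul_zero, sub_zero] at this
    simp only [id]
    linarith
  have hbot : Tendsto A atBot atBot := by
    refine tendsto_atBot_mono' _ ?_ ((tendsto_id (α := ℝ)).const_mul_atBot hk)
    filter_upwards [eventually_le_atBot 0] with x hx
    have := hmono2 hx
    simp only [hA0, mul_zero, sub_zero] at this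
    simp only [id]
    linarith
  have hsurj : Function.Surjective A := hcont.surjective htop hbot
  let e := StrictMono.orderIsoOfSurjective A hmono hsurj
  have he1 : ∀ x, A (e.symm x) = x := fun x => e.apply_symm_apply x
  have he2 : ∀ x, e.symm (A x) = x := fun x => e.symm_apply_apply x
  refine ⟨A, e.symm, hA0, hmono, he1, he2, hAd, fun x => ?_, fun x => ?_⟩
  · exact HasDerivAt.of_local_left_inverse e.symm.continuous.continuousAt (hAd _)
      (h.speed_pos _).ne' (Eventually.of_forall he1)
  · refine h.acDeriv.eq_mul_sin_cos h.acDeriv_conj h.ne_zero_or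
      (.of_hasDerivAt hAd h.continuous_speed) (fun t => ?_) one_pos ?_ ?_ x
    · have h1 := sgnPow_mul_self h.pos.ne' (C t)
      have h2 := self_mul_sgnPow h.pos.ne' (S t)
      rw [speed, ← h1, ← h2]
      ring
    · simp [hA0, h.map_zero]
    · simp [hA0, h.deriv_zero, sgnPow_of_pos]

theorem abs_conj_rpow (h : GenSine p S C) (x : ℝ) :
    |sgnPow (p - 1) x| ^ (p / (p - 1)) = |x| ^ p := by
  rw [abs_sgnPow h.sub_one_pos.ne', ← Real.rpow_mul (abs_nonneg _),
    mul_div_cancel₀ _ h.sub_one_pos.ne']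

theorem conj_pythagoras (h : GenSine p S C) (x : ℝ) :
    |S x| ^ p + |sgnPow (p - 1) (C x)| ^ (p / (p - 1)) = 1 := by
  rw [h.abs_conj_rpow, h.pythagoras]

/-- Points in the same direction on the generalized unit circle coincide. -/
theorem eq_of_same_direction (h : GenSine p S C) {a z N M σ τ : ℝ} (x : ℝ)
    (h1 : |a| ^ p + |z| ^ (p / (p - 1)) = 1) (hN : 0 < N) (hM : 0 < M)
    (ha : a = N * σ) (hz : z = N * τ) (hS : S x = M * σ) (hC : sgnPow (p - 1) (C x) = M * τ) :
    a = S x ∧ z = sgnPow (p - 1) (C x) := by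
  have hM' := hM.ne'
  have e1 : a = N / M * S x := by rw [ha, hS]; field_simp
  have e2 : z = N / M * sgnPow (p - 1) (C x) := by rw [hz, hC]; field_simp
  have := eq_one_of_abs_rpow_add_abs_rpow h.pos (div_pos h.pos h.sub_one_pos)
    (div_pos hN hM) (h.conj_pythagoras x) (by rw [← e1, ← e2]; exact h1)
  rw [this, one_mul] at e1 e2
  exact ⟨e1, e2⟩

theorem exists_eq (h : GenSine p S C) {a z : ℝ} (h1 : |a| ^ p + |z| ^ (p / (p - 1)) = 1) :
    ∃ x, a = S x ∧ z = sgnPow (p - 1) (C x) := by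
  obtain ⟨A, B, -, -, hAB, -, -, -, hpol⟩ := h.exists_angle
  have hne : a ≠ 0 ∨ z ≠ 0 := by
    by_contra! h0
    rw [h0.1, h0.2, abs_zero, Real.zero_rpow h.pos.ne',
      Real.zero_rpow (div_pos h.pos h.sub_one_pos).ne'] at h1
    norm_num at h1
  obtain ⟨N, β, hN, ha, hz⟩ := exists_eq_mul_sin_cos hne
  obtain ⟨M, hM, hS, hC⟩ := hpol (B β)
  rw [hAB] at hS hC
  exact ⟨B β, h.eq_of_same_direction (B β) h1 hN hM ha hz hS hC⟩

/-- A curve on the generalized unit circle lifts to a phase function. -/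
theorem exists_lift (h : GenSine p S C) {Y Z m : ℝ → ℝ}
    (hm : ∀ a b, IntervalIntegrable m volume a b)
    (hY : ACDeriv Y (fun t => m t * sgnPow (1 / (p - 1)) (Z t)))
    (hZ : ACDeriv Z (fun t => -(m t * ((p - 1) * sgnPow (p - 1) (Y t)))))
    (hcirc : ∀ t, |Y t| ^ p + |Z t| ^ (p / (p - 1)) = 1) {φ : ℝ} (hφ : Y 0 = S φ)
    (hφ' : Z 0 = sgnPow (p - 1) (C φ)) :
    ∃ ω : ℝ → ℝ, ω 0 = φ ∧ ACDeriv ω m ∧ ∀ t, Y t = S (ω t) ∧ Z t = sgnPow (p - 1) (C (ω t)) := by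
  obtain ⟨A, B, -, -, hAB, hBA, hAd, hBd, hpol⟩ := h.exists_angle
  have hne : ∀ t, Y t ≠ 0 ∨ Z t ≠ 0 := fun t => by
    by_contra! h0
    have h1 := hcirc t
    rw [h0.1, h0.2, abs_zero, Real.zero_rpow h.pos.ne',
      Real.zero_rpow (div_pos h.pos h.sub_one_pos).ne'] at h1
    norm_num at h1
  have hR : ∀ t, 0 < Y t ^ 2 + Z t ^ 2 := fun t => by
    rcases hne t with h | h <;> positivity
  set γ : ℝ → ℝ := fun t => (Z t * sgnPow (1 / (p - 1)) (Z t) + (p - 1) * |Y t| ^ p) /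
    (Y t ^ 2 + Z t ^ 2) with hγ
  have hγc : Continuous γ := by
    refine Continuous.div ?_ ((hY.continuous.pow 2).add (hZ.continuous.pow 2))
      fun t => (hR t).ne'
    exact (hZ.continuous.mul ((continuous_sgnPow (one_div_pos.2 h.sub_one_pos)).comp
      hZ.continuous)).add (continuous_const.mul
        ((continuous_abs_rpow h.pos.le).comp hY.continuous))
  have hi : ∀ a b, IntervalIntegrable (fun t => m t * γ t) volume a b := fun a b =>
    (hm a b).mul_continuousOn hγc.continuousOn
  set β : ℝ → ℝ := fun t => A φ + ∫ x in (0:ℝ)..t, m x * γ x with hβ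
  have hβd : ACDeriv β (fun t => m t * γ t) :=
    ((ACDeriv.const (A φ)).add (.integral hi 0)).congr (fun _ => rfl) fun t => zero_add _
  have hβ0 : β 0 = A φ := by simp [hβ]
  obtain ⟨M₀, hM₀, hS₀, hC₀⟩ := hpol φ
  have hpolY := fun t => hY.eq_mul_sin_cos hZ hne hβd (fun t => by
    have h2 := self_mul_sgnPow h.pos.ne' (Y t)
    rw [hγ]
    simp only
    rw [← h2]
    ring) hM₀ (by rw [hβ0, hφ, hS₀]) (by rw [hβ0, hφ', hC₀]) t
  have hval : ∀ t, Y t = S (B (β t)) ∧ Z t = sgnPow (p - 1) (C (B (β t))) := fun t => by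
    obtain ⟨N, hN, ha, hz⟩ := hpolY t
    obtain ⟨M, hM, hS, hC⟩ := hpol (B (β t))
    rw [hAB] at hS hC
    exact h.eq_of_same_direction _ (hcirc t) hN hM ha hz hS hC
  have hBc : Continuous B := continuous_iff_continuousAt.2 fun x => (hBd x).continuousAt
  refine ⟨fun t => B (β t), by simp only [hβ0, hBA], ?_, hval⟩
  refine (hβd.comp hBd ((h.continuous_speed.comp hBc).inv₀ fun x => (h.speed_pos _).ne')).congr
    (fun _ => rfl) fun t => ?_
  have hsp : speed p S C (B (β t)) = γ t := by
    rw [hγ, speed]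
    simp only
    rw [(hval t).1, (hval t).2, sgnPow_leftInverse h.sub_one_pos.ne',
      sgnPow_mul_self h.pos.ne']
  rw [hsp]
  have : γ t ≠ 0 := by rw [← hsp]; exact (h.speed_pos _).ne'
  field_simp

end GenSine

/-! ### The half period -/

theorem integral_rpow_mul_one_sub_rpow {α β : ℝ} (hα : 0 < α) (hβ : 0 < β) :
    ∫ x in Ioo (0:ℝ) 1, x ^ (α - 1) * (1 - x) ^ (β - 1) = ProbabilityTheory.beta α β := by
  rw [ProbabilityTheory.beta_eq_betaIntegralReal α β hα hβ, Complex.betaIntegral,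
    intervalIntegral.integral_of_le (by norm_num), ← integral_Ioc_eq_integral_Ioo,
    ← RCLike.re_to_complex, ← integral_re]
  · refine setIntegral_congr_fun measurableSet_Ioc fun x ⟨hx1, hx₂⟩ ↦ ?_
    norm_cast
    rw [← Complex.ofReal_cpow, ← Complex.ofReal_cpow, RCLike.re_to_complex,
      Complex.re_mul_ofReal, Complex.ofReal_re]
    all_goals linarith
  have := Complex.betaIntegral_convergent (u := α) (v := β) (by simpa) (by simpa)
  rwa [intervalIntegrable_iff_integrableOn_Ioc_of_le (by simp), IntegrableOn] at this

theorem beta_one_div {p : ℝ} :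
    ProbabilityTheory.beta (1 / p) (1 - 1 / p) = π / Real.sin (π / p) := by
  rw [ProbabilityTheory.beta, Real.Gamma_mul_Gamma_one_sub, add_sub_cancel, Real.Gamma_one,
    div_one, mul_one_div]

namespace GenSine

variable {p : ℝ} {S C : ℝ → ℝ}

theorem hasDerivAt_abs_rpow (h : GenSine p S C) (x : ℝ) :
    HasDerivAt (fun x => |S x| ^ p) (p * (sgnPow (p - 1) (S x) * C x)) x :=
  ((hasDerivAt_abs_rpow_sgnPow h.one_lt (S x)).comp x (h.hasDerivAt x)).congr_deriv (by ring)

theorem continuous_abs_rpow (h : GenSine p S C) : Continuous fun x => |S x| ^ p :=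
  (_root_.continuous_abs_rpow h.pos.le).comp h.continuous

theorem mul_length_eq_beta (h : GenSine p S C) {a b : ℝ} (hab : a ≤ b)
    (hinj : InjOn (fun x => |S x| ^ p) (Ioo a b))
    (himg : (fun x => |S x| ^ p) '' Ioo a b = Ioo 0 1) :
    p * (b - a) = ProbabilityTheory.beta (1 / p) (1 - 1 / p) := by
  have hp := h.pos
  have hp1 := h.sub_one_pos
  have hp2 : 1 / p < 1 := (div_lt_one hp).2 h.one_lt
  rw [← integral_rpow_mul_one_sub_rpow (one_div_pos.2 hp) (sub_pos.2 hp2), ← himg,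
    integral_image_eq_integral_abs_deriv_smul measurableSet_Ioo
      (fun x _ => (h.hasDerivAt_abs_rpow x).hasDerivWithinAt) hinj]
  have : ∀ x ∈ Ioo a b, |p * (sgnPow (p - 1) (S x) * C x)| •
      ((|S x| ^ p) ^ (1 / p - 1) * (1 - |S x| ^ p) ^ (1 - 1 / p - 1)) = p := fun x hx => by
    have hG : |S x| ^ p ∈ Ioo (0:ℝ) 1 := himg ▸ mem_image_of_mem _ hx
    have hS : 0 < |S x| := by
      rcases (abs_nonneg (S x)).eq_or_lt with h0 | h0
      · rw [← h0, Real.zero_rpow hp.ne'] at hG; exact absurd hG.1 (lt_irrefl _)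
      · exact h0
    have hCp : 1 - |S x| ^ p = |C x| ^ p := by linarith [h.pythagoras x]
    have hC : 0 < |C x| := by
      rcases (abs_nonneg (C x)).eq_or_lt with h0 | h0
      · rw [← h0, Real.zero_rpow hp.ne'] at hCp; linarith [hG.2]
      · exact h0
    rw [hCp, ← Real.rpow_mul hS.le, ← Real.rpow_mul hC.le, abs_mul, abs_mul,
      abs_sgnPow hp1.ne', abs_of_pos hp, smul_eq_mul]
    have e1 : p * (1 / p - 1) = -(p - 1) := by field_simp; ring
    have e2 : p * (1 - 1 / p - 1) = -1 := by field_simp; ring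
    rw [e1, e2, Real.rpow_neg hS.le, Real.rpow_neg hC.le, Real.rpow_one]
    have := (Real.rpow_pos_of_pos hS (p - 1)).ne'
    field_simp
  rw [setIntegral_congr_fun measurableSet_Ioo this]
  simp [hab, mul_comm]

theorem exists_halfPeriod (h : GenSine p S C) : ∃ T : ℝ, 0 < T ∧
    (∀ x, S (x + T) = -S x ∧ C (x + T) = -C x) ∧ (∀ x ∈ Ioo 0 T, 0 < S x) ∧
    (∀ x x', S x' = -S x → C x' = -C x → ∃ k : ℤ, x' - x = (2 * k + 1) * T) ∧
    ∃ m ∈ Ioo 0 T, (∀ x ∈ Ioo 0 m, 0 < C x) ∧ (∀ x ∈ Ioo m T, C x < 0) ∧ C m = 0 := by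
  obtain ⟨A, B, hA0, hmono, hAB, hBA, hAd, hBd, hpol⟩ := h.exists_angle
  have hBmono : StrictMono B := fun x y hxy => by rwa [← hmono.lt_iff_lt, hAB, hAB]
  have hB0 : B 0 = 0 := by simpa only [hA0] using hBA 0
  have hT : 0 < B π := hB0 ▸ hBmono Real.pi_pos
  have hST : S (B π) = 0 ∧ sgnPow (p - 1) (C (B π)) = -1 := by
    obtain ⟨N, hN, hS, hC⟩ := hpol (B π)
    rw [hAB] at hS hC
    have := h.eq_of_same_direction (a := 0) (z := -1) (B π)
      (by simp [Real.zero_rpow h.pos.ne']) (N := 1) (M := N) one_pos hN (by simp) (by simp) hS hC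
    exact ⟨this.1.symm, this.2.symm⟩
  have hshift : ∀ x, S (x + B π) = -S x ∧ C (x + B π) = -C x := by
    obtain ⟨ω, hω0, hω, hv⟩ := h.exists_lift (Y := fun x => -S x)
      (Z := fun x => -sgnPow (p - 1) (C x)) (m := fun _ => 1) (φ := B π)
      (fun a b => intervalIntegrable_const)
      ((h.acDeriv.const_mul (-1)).congr (fun x => by ring) fun x => by
        rw [sgnPow_neg, sgnPow_leftInverse h.sub_one_pos.ne']; ring)
      ((h.acDeriv_conj.const_mul (-1)).congr (fun x => by ring) fun x => by
        rw [sgnPow_neg]; ring)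
      (fun t => by simpa using h.conj_pythagoras t)
      (by rw [hST.1, h.map_zero, neg_zero])
      (by rw [hST.2, h.deriv_zero, sgnPow_of_pos _ one_pos, Real.one_rpow])
    intro x
    have hx : ω x = x + B π := by
      rw [hω.eq_add_integral, hω0]; simp [add_comm]
    have := hv x
    rw [hx] at this
    refine ⟨this.1.symm, sgnPow_injective h.sub_one_pos.ne' ?_⟩
    rw [← this.2, sgnPow_neg]
  have hAshift : ∀ x, A (x + B π) = A x + π := by
    have hd : ∀ x, HasDerivAt (fun x => A (x + B π) - A x) 0 x := fun x => by
      refine (((hAd (x + B π)).comp_add_const x (B π)).sub (hAd x)).congr_deriv ?_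
      simp [speed, (hshift x).1, (hshift x).2, sgnPow_neg]
    intro x
    have := is_const_of_deriv_eq_zero (fun x => (hd x).differentiableAt)
      (fun x => (hd x).deriv) x 0
    simp only [zero_add, hA0, hAB, sub_zero] at this
    linarith
  have hAnat : ∀ (n : ℕ) x, A (x + n * B π) = A x + n * π := fun n => by
    induction n with
    | zero => simp
    | succ n ih =>
      intro x
      push_cast
      rw [show x + (n + 1) * B π = (x + n * B π) + B π by ring, hAshift, ih]
      ring
  have hAint : ∀ (n : ℤ) x, A (x + n * B π) = A x + n * π := fun n x => by
    obtain ⟨k, rfl | rfl⟩ := n.eq_nat_or_neg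
    · exact_mod_cast hAnat k x
    · have := hAnat k (x + (-(k:ℤ) : ℤ) * B π)
      push_cast at this ⊢
      rw [show x + -(k:ℝ) * B π + k * B π = x by ring] at this
      linarith
  refine ⟨B π, hT, hshift, fun x hx => ?_, fun x x' hS hC => ?_, B (π / 2), ?_, fun x hx => ?_,
    fun x hx => ?_, ?_⟩
  · obtain ⟨N, hN, hS, -⟩ := hpol x
    rw [hS]
    refine mul_pos hN (Real.sin_pos_of_pos_of_lt_pi ?_ ?_)
    · rw [← hA0]; exact hmono hx.1
    · rw [← hAB π]; exact hmono hx.2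
  · obtain ⟨N, hN, hSx, hCx⟩ := hpol x
    obtain ⟨M, hM, hSx', hCx'⟩ := hpol x'
    have hZ : sgnPow (p - 1) (C x') = -sgnPow (p - 1) (C x) := by rw [hC, sgnPow_neg]
    rw [hS, hSx] at hSx'
    rw [hZ, hCx] at hCx'
    have hM' := hM.ne'
    have e1 : Real.sin (A x') = -(N / M) * Real.sin (A x) := by field_simp; linarith
    have e2 : Real.cos (A x') = -(N / M) * Real.cos (A x) := by field_simp; linarith
    have hNM : 0 < N / M := div_pos hN hM
    have hcos : Real.cos (A x' - A x) = -(N / M) := by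
      rw [Real.cos_sub, e1, e2]
      linear_combination -(N / M) * Real.sin_sq_add_cos_sq (A x)
    have hone : N / M = 1 := by
      have h1 := Real.sin_sq_add_cos_sq (A x')
      rw [e1, e2] at h1
      have h2 : (N / M) ^ 2 = 1 := by
        linear_combination h1 - (N / M) ^ 2 * Real.sin_sq_add_cos_sq (A x)
      nlinarith
    rw [hone] at hcos
    obtain ⟨k, hk⟩ := Real.cos_eq_neg_one_iff.1 hcos
    refine ⟨k, ?_⟩
    have h1 := hAint (2 * k + 1) x
    have : A x' = A (x + (2 * k + 1 : ℤ) * B π) := by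
      rw [h1]; push_cast; linarith
    have := hmono.injective this
    rw [this]; push_cast; ring
  · exact ⟨hB0 ▸ hBmono (by positivity), hBmono (by linarith [Real.pi_pos])⟩
  · obtain ⟨N, hN, -, hC⟩ := hpol x
    rw [← sgnPow_pos_iff (p - 1), hC]
    have h1 : A x < π / 2 := by rw [← hAB (π / 2)]; exact hmono hx.2
    have h2 : 0 < A x := by rw [← hA0]; exact hmono hx.1
    exact mul_pos hN (Real.cos_pos_of_mem_Ioo ⟨by linarith [Real.pi_pos], h1⟩)
  · obtain ⟨N, hN, -, hC⟩ := hpol x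
    rw [← sgnPow_neg_iff (p - 1), hC]
    have h1 : π / 2 < A x := by rw [← hAB (π / 2)]; exact hmono hx.1
    have h2 : A x < π := by rw [← hAB π]; exact hmono hx.2
    exact mul_neg_of_pos_of_neg hN
      (Real.cos_neg_of_pi_div_two_lt_of_lt h1 (by linarith [Real.pi_pos]))
  · obtain ⟨N, hN, -, hC⟩ := hpol (B (π / 2))
    rw [hAB, Real.cos_pi_div_two, mul_zero] at hC
    exact sgnPow_injective h.sub_one_pos.ne' (hC.trans (sgnPow_zero _).symm)

/-- The half period of the generalized sine function is `π̂`. -/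
theorem pihat_spec (h : GenSine p S C) : 0 < pihat p ∧
    (∀ x, S (x + pihat p) = -S x ∧ C (x + pihat p) = -C x) ∧ (∀ x ∈ Ioo 0 (pihat p), 0 < S x) ∧
    (∀ x x', S x' = -S x → C x' = -C x → ∃ k : ℤ, x' - x = (2 * k + 1) * pihat p) ∧
    ∃ m ∈ Ioo 0 (pihat p), C m = 0 := by
  obtain ⟨T, hT, hshift, hSpos, hper, m, hm, hC1, hC2, hCm⟩ := h.exists_halfPeriod
  suffices hTp : pihat p = T by
    rw [hTp]; exact ⟨hT, hshift, hSpos, hper, m, hm, hCm⟩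
  have hST : S T = 0 := by simpa [h.map_zero] using (hshift 0).1
  have hG0 : |S 0| ^ p = 0 := by rw [h.map_zero, abs_zero, Real.zero_rpow h.pos.ne']
  have hGT : |S T| ^ p = 0 := by rw [hST, abs_zero, Real.zero_rpow h.pos.ne']
  have hGm : |S m| ^ p = 1 := by
    have := h.pythagoras m
    rwa [hCm, abs_zero, Real.zero_rpow h.pos.ne', add_zero] at this
  have hup : StrictMonoOn (fun x => |S x| ^ p) (Icc 0 m) := by
    refine strictMonoOn_of_deriv_pos (convex_Icc 0 m) h.continuous_abs_rpow.continuousOn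
      fun x hx => ?_
    rw [interior_Icc] at hx
    rw [(h.hasDerivAt_abs_rpow x).deriv]
    have h1 := hSpos x ⟨hx.1, hx.2.trans hm.2⟩
    have h2 := hC1 x hx
    have h3 := h.pos
    rw [sgnPow_of_pos _ h1]
    positivity
  have hdown : StrictAntiOn (fun x => |S x| ^ p) (Icc m T) := by
    refine strictAntiOn_of_deriv_neg (convex_Icc m T) h.continuous_abs_rpow.continuousOn
      fun x hx => ?_
    rw [interior_Icc] at hx
    rw [(h.hasDerivAt_abs_rpow x).deriv]
    have h1 := hSpos x ⟨hm.1.trans hx.1, hx.2⟩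
    have h2 := hC2 x hx
    rw [sgnPow_of_pos _ h1]
    exact mul_neg_of_pos_of_neg h.pos
      (mul_neg_of_pos_of_neg (Real.rpow_pos_of_pos h1 _) h2)
  have e1 := h.mul_length_eq_beta hm.1.le (hup.injOn.mono Ioo_subset_Icc_self) (by
    refine Subset.antisymm ?_ ?_
    · rintro _ ⟨x, hx, rfl⟩
      refine ⟨?_, ?_⟩
      · rw [← hG0]
        exact hup (left_mem_Icc.2 hm.1.le) (Ioo_subset_Icc_self hx) hx.1
      · rw [← hGm]
        exact hup (Ioo_subset_Icc_self hx) (right_mem_Icc.2 hm.1.le) hx.2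
    · have := intermediate_value_Ioo hm.1.le h.continuous_abs_rpow.continuousOn
      rwa [hG0, hGm] at this)
  have e2 := h.mul_length_eq_beta hm.2.le (hdown.injOn.mono Ioo_subset_Icc_self) (by
    refine Subset.antisymm ?_ ?_
    · rintro _ ⟨x, hx, rfl⟩
      refine ⟨?_, ?_⟩
      · rw [← hGT]
        exact hdown (Ioo_subset_Icc_self hx) (right_mem_Icc.2 hm.2.le) hx.2
      · rw [← hGm]
        exact hdown (left_mem_Icc.2 hm.2.le) (Ioo_subset_Icc_self hx) hx.1
    · have := intermediate_value_Ioo' hm.2.le h.continuous_abs_rpow.continuousOn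
      rwa [hGT, hGm] at this)
  rw [beta_one_div] at e1 e2
  have hp := h.pos.ne'
  have : p * T = 2 * (π / Real.sin (π / p)) := by linarith
  rw [pihat, mul_comm p, ← div_div, mul_div_assoc, ← this]
  field_simp

end GenSine

/-! ### The phase equation -/

theorem abs_le_cosh (x : ℝ) : |x| ≤ Real.cosh x := by
  rw [← Real.cosh_abs, Real.cosh_eq]
  have h1 := Real.quadratic_le_exp_of_nonneg (abs_nonneg x)
  have h2 := Real.exp_pos (-|x|)
  have h3 := Real.add_one_le_exp (-|x|)
  nlinarith [sq_nonneg (|x| - 1)]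

theorem abs_sinh_le_cosh (x : ℝ) : |Real.sinh x| ≤ Real.cosh x := by
  rw [abs_le, Real.sinh_eq, Real.cosh_eq]
  constructor <;> linarith [Real.exp_pos x, Real.exp_pos (-x)]

/-- Carathéodory existence for `θ' = κ + b(t) G(θ)` with `b` locally integrable and `G` bounded and
Lipschitz. -/
theorem exists_phase {G b : ℝ → ℝ} {K : ℝ} (hK : 0 < K) (hG : ∀ x y, |G x - G y| ≤ K * |x - y|)
    (hG1 : ∀ x, |G x| ≤ 1) (hb : ∀ x y, IntervalIntegrable b volume x y) (κ φ : ℝ) :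
    ∃ θ : ℝ → ℝ, θ 0 = φ ∧ ACDeriv θ (fun t => κ + b t * G (θ t)) := by
  have hGc : Continuous G :=
    (LipschitzWith.of_dist_le_mul (K := K.toNNReal) fun x y => by
      rw [Real.dist_eq, Real.dist_eq, Real.coe_toNNReal K hK.le]; exact hG x y).continuous
  set β : ℝ → ℝ := fun t => ∫ s in (0:ℝ)..t, |b s| with hβ
  have hβd : ACDeriv β (fun t => |b t|) := .integral (fun x y => (hb x y).abs) 0
  set w : ℝ → ℝ := fun t => Real.cosh (2 * K * β t) with hw
  have hwc : Continuous w := Real.continuous_cosh.comp (continuous_const.mul hβd.continuous)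
  have hwpos : ∀ t, 0 < w t := fun t => Real.cosh_pos _
  have hwint : ∀ t, ∫ s in (0:ℝ)..t, |b s| * w s = Real.sinh (2 * K * β t) / (2 * K) := fun t => by
    have h1 := (((hβd.const_mul (2 * K)).comp Real.hasDerivAt_sinh
      Real.continuous_cosh).const_mul (2 * K)⁻¹).congr (g' := fun s => |b s| * w s)
      (fun _ => rfl) fun s => by rw [hw]; field_simp
    have h2 := h1.integral_eq_sub 0 t
    simp only [hβ, intervalIntegral.integral_same, mul_zero, Real.sinh_zero, sub_zero] at h2
    rw [h2, div_eq_inv_mul]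
  let Θ : BoundedContinuousFunction ℝ ℝ → ℝ → ℝ := fun u t => φ + κ * t + w t * u t
  have hΘc : ∀ u, Continuous (Θ u) := fun u =>
    (continuous_const.add (continuous_const.mul continuous_id)).add (hwc.mul u.continuous)
  have hi : ∀ u x y, IntervalIntegrable (fun s => b s * G (Θ u s)) volume x y := fun u x y =>
    (hb x y).mul_continuousOn (hGc.comp (hΘc u)).continuousOn
  let I : BoundedContinuousFunction ℝ ℝ → ℝ → ℝ := fun u t => ∫ s in (0:ℝ)..t, b s * G (Θ u s)
  have hIc : ∀ u, Continuous fun t => I u t / w t := fun u =>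
    (ACDeriv.integral (hi u) 0).continuous.div hwc fun t => (hwpos t).ne'
  have hIb : ∀ u t, ‖I u t / w t‖ ≤ (2 * K)⁻¹ := fun u t => by
    have h1 : ‖I u t‖ ≤ |β t| := by
      refine intervalIntegral.norm_integral_le_abs_of_norm_le (ae_of_all _ fun s => ?_)
        (hb 0 t).abs
      rw [Real.norm_eq_abs, abs_mul]
      exact mul_le_of_le_one_right (abs_nonneg _) (hG1 _)
    have h2 := abs_le_cosh (2 * K * β t)
    rw [abs_mul, abs_of_pos (by positivity : 0 < 2 * K)] at h2
    rw [norm_div, Real.norm_of_nonneg (hwpos t).le, div_le_iff₀ (hwpos t)]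
    refine h1.trans ?_
    rw [le_inv_mul_iff₀ (by positivity)]
    exact h2
  let Ψ : BoundedContinuousFunction ℝ ℝ → BoundedContinuousFunction ℝ ℝ := fun u =>
    BoundedContinuousFunction.ofNormedAddCommGroup (fun t => I u t / w t) (hIc u) _ (hIb u)
  have hΨ : ContractingWith (1 / 2) Ψ := by
    refine ⟨by norm_num [← NNReal.coe_lt_coe], LipschitzWith.of_dist_le_mul fun u v => ?_⟩
    rw [BoundedContinuousFunction.dist_le (by positivity)]
    intro t
    change dist (I u t / w t) (I v t / w t) ≤ _
    have h1 : |I u t - I v t| ≤ |∫ s in (0:ℝ)..t, K * dist u v * (|b s| * w s)| := by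
      simp only [I]
      rw [← intervalIntegral.integral_sub (hi u 0 t) (hi v 0 t)]
      refine intervalIntegral.norm_integral_le_abs_of_norm_le (E := ℝ) (μ := volume)
        (f := fun s => b s * G (Θ u s) - b s * G (Θ v s))
        (g := fun s => K * dist u v * (|b s| * w s)) (ae_of_all _ fun s => ?_)
        (((hb 0 t).abs.mul_continuousOn hwc.continuousOn).const_mul _)
      rw [← mul_sub, Real.norm_eq_abs, abs_mul]
      have h2 := hG (Θ u s) (Θ v s)
      have h3 : Θ u s - Θ v s = w s * (u s - v s) := by simp only [Θ]; ring
      rw [h3, abs_mul, abs_of_pos (hwpos s)] at h2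
      have h4 : |u s - v s| ≤ dist u v := by
        rw [← Real.dist_eq]; exact BoundedContinuousFunction.dist_coe_le_dist s
      calc |b s| * |G (Θ u s) - G (Θ v s)| ≤ |b s| * (K * (w s * dist u v)) := by
            have := (hwpos s).le
            refine mul_le_mul_of_nonneg_left (h2.trans ?_) (abs_nonneg _)
            gcongr
        _ = _ := by ring
    rw [intervalIntegral.integral_const_mul, hwint, abs_mul, abs_div,
      abs_of_nonneg (by positivity : 0 ≤ K * dist u v), abs_of_pos (by positivity : 0 < 2 * K)]
      at h1
    rw [Real.dist_eq, ← sub_div, abs_div, abs_of_pos (hwpos t), div_le_iff₀ (hwpos t)]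
    have h5 := abs_sinh_le_cosh (2 * K * β t)
    calc |I u t - I v t| ≤ K * dist u v * (|Real.sinh (2 * K * β t)| / (2 * K)) := h1
      _ = 1 / 2 * dist u v * |Real.sinh (2 * K * β t)| := by field_simp
      _ ≤ 1 / 2 * dist u v * w t := by gcongr
      _ = _ := by norm_num
  have hfix := hΨ.fixedPoint_isFixedPt
  set u := ContractingWith.fixedPoint Ψ hΨ
  have hu : ∀ t, w t * u t = I u t := fun t => by
    have h1 : Ψ u t = u t := by rw [hfix]
    change I u t / w t = u t at h1
    have := (hwpos t).ne'
    rw [← h1]; field_simp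
  refine ⟨Θ u, ?_, ?_⟩
  · have h0 : I u 0 = 0 := intervalIntegral.integral_same
    simp only [Θ, hu, h0]; ring
  · have hlin : ACDeriv (fun t => φ + κ * t) fun _ => κ :=
      .of_hasDerivAt (fun t => (((hasDerivAt_id t).const_mul κ).const_add φ).congr_deriv (by ring))
        continuous_const
    exact (hlin.add (.integral (hi u) 0)).congr
      (fun t => by change _ = φ + κ * t + w t * u t; rw [hu])
      fun t => rfl

/-- The averaged derivative of `G` over the segment from `y` to `x`. -/
noncomputable def avgDeriv (G' : ℝ → ℝ) (x y : ℝ) : ℝ := ∫ s in (0:ℝ)..1, G' (y + s * (x - y))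

theorem avgDeriv_self (G' : ℝ → ℝ) (x : ℝ) : avgDeriv G' x x = G' x := by simp [avgDeriv]

theorem abs_avgDeriv_le {G' : ℝ → ℝ} {K : ℝ} (hK : ∀ x, |G' x| ≤ K) (x y : ℝ) :
    |avgDeriv G' x y| ≤ K := by
  have := intervalIntegral.norm_integral_le_of_norm_le_const (a := (0:ℝ)) (b := 1) (C := K)
    (f := fun s => G' (y + s * (x - y))) fun s _ => hK _
  simpa [avgDeriv] using this

theorem continuous_avgDeriv {G' : ℝ → ℝ} (hG' : Continuous G') :
    Continuous fun z : ℝ × ℝ => avgDeriv G' z.1 z.2 := by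
  refine intervalIntegral.continuous_parametric_intervalIntegral_of_continuous' ?_ 0 1
  fun_prop

theorem sub_eq_avgDeriv_mul {G G' : ℝ → ℝ} (hG : ∀ x, HasDerivAt G (G' x) x)
    (hG' : Continuous G') (x y : ℝ) : G x - G y = avgDeriv G' x y * (x - y) := by
  have h1 := intervalIntegral.integral_eq_sub_of_hasDerivAt (a := (0:ℝ)) (b := 1)
    (f := fun s => G (y + s * (x - y))) (f' := fun s => G' (y + s * (x - y)) * (x - y))
    (fun s _ => (hG _).comp s ((((hasDerivAt_id s).mul_const (x - y)).const_add y).congr_deriv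
      (one_mul _)))
    (by apply Continuous.intervalIntegrable; fun_prop)
  rw [intervalIntegral.integral_mul_const] at h1
  simp only [one_mul, zero_mul, add_zero, add_sub_cancel] at h1
  exact h1.symm

/-- Two phases with the same drift differ by the solution of a linear equation. -/
theorem ACDeriv.phase_sub {G G' b₁ b₂ θ₁ θ₂ : ℝ → ℝ} {κ : ℝ} (hG : ∀ x, HasDerivAt G (G' x) x)
    (hG' : Continuous G') (h₁ : ACDeriv θ₁ fun t => κ + b₁ t * G (θ₁ t))
    (h₂ : ACDeriv θ₂ fun t => κ + b₂ t * G (θ₂ t)) :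
    ACDeriv (fun t => θ₁ t - θ₂ t) fun t => b₁ t * avgDeriv G' (θ₁ t) (θ₂ t) * (θ₁ t - θ₂ t) +
      (b₁ t - b₂ t) * G (θ₂ t) :=
  (h₁.sub h₂).congr (fun _ => rfl) fun t => by
    have := sub_eq_avgDeriv_mul hG hG' (θ₁ t) (θ₂ t)
    linear_combination b₁ t * this

theorem intervalIntegrable_mul_avgDeriv {G' b θ₁ θ₂ : ℝ → ℝ} (hG' : Continuous G')
    (hb : ∀ x y, IntervalIntegrable b volume x y) (h₁ : Continuous θ₁) (h₂ : Continuous θ₂)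
    (x y : ℝ) : IntervalIntegrable (fun t => b t * avgDeriv G' (θ₁ t) (θ₂ t)) volume x y :=
  (hb x y).mul_continuousOn ((continuous_avgDeriv hG').comp (h₁.prodMk h₂)).continuousOn

theorem phase_sub_eq {G G' b θ₁ θ₂ : ℝ → ℝ} {κ : ℝ} (hG : ∀ x, HasDerivAt G (G' x) x)
    (hG' : Continuous G') (hb : ∀ x y, IntervalIntegrable b volume x y)
    (h₁ : ACDeriv θ₁ fun t => κ + b t * G (θ₁ t))
    (h₂ : ACDeriv θ₂ fun t => κ + b t * G (θ₂ t)) (t : ℝ) :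
    θ₁ t - θ₂ t =
      (θ₁ 0 - θ₂ 0) * Real.exp (∫ s in (0:ℝ)..t, b s * avgDeriv G' (θ₁ s) (θ₂ s)) :=
  ((h₁.phase_sub hG hG' h₂).congr (fun _ => rfl) fun t => by
    rw [sub_self, zero_mul, add_zero]).linear_homogeneous_eq
      (intervalIntegrable_mul_avgDeriv hG' hb h₁.continuous h₂.continuous) t

theorem phase_unique {G G' b θ₁ θ₂ : ℝ → ℝ} {κ : ℝ} (hG : ∀ x, HasDerivAt G (G' x) x)
    (hG' : Continuous G') (hb : ∀ x y, IntervalIntegrable b volume x y)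
    (h₁ : ACDeriv θ₁ fun t => κ + b t * G (θ₁ t))
    (h₂ : ACDeriv θ₂ fun t => κ + b t * G (θ₂ t)) (h0 : θ₁ 0 = θ₂ 0) (t : ℝ) : θ₁ t = θ₂ t := by
  have := phase_sub_eq hG hG' hb h₁ h₂ t
  rw [h0, sub_self, zero_mul] at this
  exact sub_eq_zero.1 this

/-- Continuous dependence of the phase on the initial value and on an additive parameter. -/
theorem abs_phase_sub_le {G G' b₁ b₂ θ₁ θ₂ : ℝ → ℝ} {κ K c : ℝ}
    (hG : ∀ x, HasDerivAt G (G' x) x) (hG' : Continuous G') (hK : ∀ x, |G' x| ≤ K)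
    (hG1 : ∀ x, |G x| ≤ 1) (hb₁ : ∀ x y, IntervalIntegrable b₁ volume x y)
    (hc : ∀ t, b₁ t - b₂ t = c) (h₁ : ACDeriv θ₁ fun t => κ + b₁ t * G (θ₁ t))
    (h₂ : ACDeriv θ₂ fun t => κ + b₂ t * G (θ₂ t)) {t : ℝ} (ht : t ∈ Icc (0:ℝ) 1) :
    |θ₁ t - θ₂ t| ≤ Real.exp (2 * (K * ∫ s in (0:ℝ)..1, |b₁ s|)) * (|θ₁ 0 - θ₂ 0| + |c|) := by
  have hK0 : 0 ≤ K := (abs_nonneg _).trans (hK 0)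
  set a : ℝ → ℝ := fun t => b₁ t * avgDeriv G' (θ₁ t) (θ₂ t)
  have ha : ∀ x y, IntervalIntegrable a volume x y :=
    intervalIntegrable_mul_avgDeriv hG' hb₁ h₁.continuous h₂.continuous
  set M := K * ∫ s in (0:ℝ)..1, |b₁ s| with hM
  have hbound : ∀ s ∈ Icc (0:ℝ) 1, |∫ x in (0:ℝ)..s, a x| ≤ M := fun s hs => by
    calc |∫ x in (0:ℝ)..s, a x| ≤ ∫ x in (0:ℝ)..s, |a x| :=
          intervalIntegral.abs_integral_le_integral_abs hs.1
      _ ≤ ∫ x in (0:ℝ)..s, K * |b₁ x| := by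
          refine intervalIntegral.integral_mono_on hs.1 (ha 0 s).abs
            ((hb₁ 0 s).abs.const_mul K) fun x _ => ?_
          rw [abs_mul, mul_comm]
          exact mul_le_mul_of_nonneg_right (abs_avgDeriv_le hK _ _) (abs_nonneg _)
      _ = K * ∫ x in (0:ℝ)..s, |b₁ x| := intervalIntegral.integral_const_mul _ _
      _ ≤ M := by
          refine mul_le_mul_of_nonneg_left ?_ hK0
          exact intervalIntegral.integral_mono_interval le_rfl hs.1 hs.2
            (ae_of_all _ fun x => abs_nonneg _) (hb₁ 0 1).abs
  have hlin := (h₁.phase_sub hG hG' h₂).linear_eq ha t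
  simp only [hc] at hlin
  have h_int : |∫ s in (0:ℝ)..t, Real.exp (-∫ x in (0:ℝ)..s, a x) * (c * G (θ₂ s))| ≤
      Real.exp M * |c| := by
    have := intervalIntegral.norm_integral_le_of_norm_le_const (a := (0:ℝ)) (b := t)
      (C := Real.exp M * |c|)
      (f := fun s => Real.exp (-∫ x in (0:ℝ)..s, a x) * (c * G (θ₂ s))) fun s hs => by
        rw [uIoc_of_le ht.1] at hs
        have h3 := (abs_le.1 (hbound s ⟨hs.1.le, hs.2.trans ht.2⟩)).1
        rw [Real.norm_eq_abs, abs_mul, abs_mul, Real.abs_exp]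
        have h4 : Real.exp (-∫ x in (0:ℝ)..s, a x) ≤ Real.exp M :=
          Real.exp_le_exp.2 (by linarith)
        have h5 : |c| * |G (θ₂ s)| ≤ |c| := mul_le_of_le_one_right (abs_nonneg _) (hG1 _)
        gcongr
    rw [Real.norm_eq_abs, sub_zero, abs_of_nonneg ht.1] at this
    exact this.trans (mul_le_of_le_one_right (by positivity) ht.2)
  have hM0 : 0 ≤ M := (abs_nonneg _).trans (hbound t ht)
  rw [hlin, abs_mul, Real.abs_exp]
  have h6 := (abs_le.1 (hbound t ht)).2
  calc Real.exp (∫ x in (0:ℝ)..t, a x) * |θ₁ 0 - θ₂ 0 +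
        ∫ s in (0:ℝ)..t, Real.exp (-∫ x in (0:ℝ)..s, a x) * (c * G (θ₂ s))|
      ≤ Real.exp M * (|θ₁ 0 - θ₂ 0| + Real.exp M * |c|) := by
        gcongr
        exact (abs_add_le _ _).trans (by gcongr)
    _ ≤ Real.exp M * (Real.exp M * |θ₁ 0 - θ₂ 0| + Real.exp M * |c|) := by
        gcongr
        exact le_mul_of_one_le_left (abs_nonneg _) (Real.one_le_exp hM0)
    _ = Real.exp (2 * M) * (|θ₁ 0 - θ₂ 0| + |c|) := by
        rw [two_mul, Real.exp_add]; ring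

/-! ### Eigenfunctions and phases -/

/-- The coefficient of the phase equation `θ' = κ + b |S(θ)|^p` with reference frequency `κ`. -/
noncomputable def phaseCoeff (p : ℝ) (q : ℝ → ℝ) (κ lam t : ℝ) : ℝ :=
  κ ^ (1 - p) * (lam - q t) - κ

theorem intervalIntegrable_phaseCoeff {q : ℝ → ℝ}
    (hq : ∀ x y, IntervalIntegrable q volume x y) (p κ lam x y : ℝ) :
    IntervalIntegrable (phaseCoeff p q κ lam) volume x y :=
  ((intervalIntegrable_const.sub (hq x y)).const_mul _).sub intervalIntegrable_const

theorem sgnPow_exp (r x : ℝ) : sgnPow r (Real.exp x) = Real.exp (r * x) := by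
  rw [sgnPow_of_pos _ (Real.exp_pos x), ← Real.exp_mul, mul_comm]

theorem exp_rpow (x r : ℝ) : Real.exp x ^ r = Real.exp (r * x) := by
  rw [← Real.exp_mul, mul_comm]

theorem rpow_sub_one_mul_rpow_one_sub {κ : ℝ} (hκ : 0 < κ) (p : ℝ) :
    κ ^ (p - 1) * κ ^ (1 - p) = 1 := by
  rw [← Real.rpow_add hκ]; simp

namespace GenSine

variable {p : ℝ} {S C : ℝ → ℝ}

/-- A phase advancing by a half period with balanced amplitude yields an anti-periodic
eigenfunction. -/
theorem isAntiPeriodicEig_of_phase (h : GenSine p S C) {q θ : ℝ → ℝ} {κ lam : ℝ} (hκ : 0 < κ)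
    (hq : ∀ x y, IntervalIntegrable q volume x y)
    (hθ : ACDeriv θ fun t => κ + phaseCoeff p q κ lam t * |S (θ t)| ^ p)
    (hθ1 : θ 1 = θ 0 + pihat p)
    (hbal : ∫ t in (0:ℝ)..1, phaseCoeff p q κ lam t *
      (p * (sgnPow (p - 1) (S (θ t)) * C (θ t))) = 0) : IsAntiPeriodicEig p q lam := by
  obtain ⟨-, hshift, -, -, -⟩ := h.pihat_spec
  set b := phaseCoeff p q κ lam with hb
  have hbi := intervalIntegrable_phaseCoeff hq p κ lam
  have hSθ := hθ.comp h.hasDerivAt h.continuous_deriv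
  have hZθ := hθ.comp h.hasDerivAt_sgnPow h.continuous_conj_deriv
  have hsc : Continuous fun t => sgnPow (p - 1) (S (θ t)) * C (θ t) :=
    ((continuous_sgnPow h.sub_one_pos).comp (h.continuous.comp hθ.continuous)).mul
      (h.continuous_deriv.comp hθ.continuous)
  set ρ : ℝ → ℝ := fun t => -(b t * (sgnPow (p - 1) (S (θ t)) * C (θ t))) with hρ
  have hρi : ∀ x y, IntervalIntegrable ρ volume x y := fun x y =>
    ((hbi x y).mul_continuousOn hsc.continuousOn).neg
  set e : ℝ → ℝ := fun t => ∫ s in (0:ℝ)..t, ρ s with he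
  have hed : ACDeriv e ρ := .integral hρi 0
  have he0 : e 0 = 0 := intervalIntegral.integral_same
  have he1 : e 1 = 0 := by
    have h1 : ∀ t, b t * (p * (sgnPow (p - 1) (S (θ t)) * C (θ t))) = -p * ρ t := fun t => by
      rw [hρ]; ring
    simp only [h1, intervalIntegral.integral_const_mul] at hbal
    exact (mul_eq_zero.1 hbal).resolve_left (neg_ne_zero.2 h.pos.ne')
  have hG : ∀ t, sgnPow (p - 1) (S (θ t)) * S (θ t) = |S (θ t)| ^ p := fun t =>
    sgnPow_mul_self h.pos.ne' _
  have hC : ∀ t, sgnPow (p - 1) (C (θ t)) * C (θ t) = 1 - |S (θ t)| ^ p := fun t => by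
    rw [sgnPow_mul_self h.pos.ne', ← h.pythagoras (θ t)]; ring
  have hyd := (hed.exp.mul hSθ).congr (g' := fun t => κ * Real.exp (e t) * C (θ t))
    (fun _ => rfl) fun t => by
      rw [hρ]
      linear_combination -Real.exp (e t) * b t * C (θ t) * hG t
  have hvc : Continuous fun t => κ * Real.exp (e t) * C (θ t) :=
    (continuous_const.mul hed.exp.continuous).mul (h.continuous_deriv.comp hθ.continuous)
  have hderiv : deriv (fun t => Real.exp (e t) * S (θ t)) = fun t => κ * Real.exp (e t) * C (θ t) :=
    funext fun t => (hyd.hasDerivAt hvc t).deriv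
  have hκ1 := rpow_sub_one_mul_rpow_one_sub hκ p
  have hWd := ((((hed.const_mul (p - 1)).exp.mul hZθ).const_mul (κ ^ (p - 1)))).congr
    (g := fun t => sgnPow (p - 1) (κ * Real.exp (e t) * C (θ t)))
    (g' := fun t => -((p - 1) * (lam - q t) * sgnPow (p - 1) (Real.exp (e t) * S (θ t))))
    (fun t => by rw [sgnPow_mul, sgnPow_mul, sgnPow_of_pos _ hκ, sgnPow_exp, mul_assoc])
    fun t => by
      rw [sgnPow_mul, sgnPow_exp, hρ]
      have hb' : κ ^ (p - 1) * (κ + b t) = lam - q t := by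
        rw [hb, phaseCoeff]; linear_combination (lam - q t) * hκ1
      rw [← hb']
      linear_combination -(κ ^ (p - 1) * Real.exp ((p - 1) * e t) * (p - 1) * b t *
        sgnPow (p - 1) (S (θ t))) * hC t
  refine ⟨fun t => Real.exp (e t) * S (θ t),
    fun t => (hyd.hasDerivAt hvc t).differentiableAt, ?_, fun x y => ?_, ?_, ?_⟩
  · by_contra! h0
    have h1 : deriv (fun t => Real.exp (e t) * S (θ t)) 0 = 0 := by
      rw [funext h0]; simp
    rw [hderiv] at h1
    have h2 : S (θ 0) = 0 := by simpa using h0 0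
    have h3 : C (θ 0) = 0 := by simpa [hκ.ne'] using h1
    have := h.ne_zero_or (θ 0)
    rw [h2, h3, sgnPow_zero] at this
    simp at this
  · rw [hderiv, ← hWd.integral_eq_sub x y, intervalIntegral.integral_neg]
  · simp [he0, he1, hθ1, (hshift _).1]
  · simp [hderiv, he0, he1, hθ1, (hshift _).2]

theorem abs_sgnPow_mul_le (h : GenSine p S C) (y u : ℝ) :
    |sgnPow (p - 1) y * u| ≤ |y| ^ p + |u| ^ p := by
  have key : |y| ^ (p - 1) * |u| ≤ max |y| |u| ^ (p - 1) * max |y| |u| := by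
    have := h.sub_one_pos.le
    gcongr
    · exact le_max_left _ _
    · exact le_max_right _ _
  rw [abs_mul, abs_sgnPow h.sub_one_pos.ne']
  refine key.trans ?_
  have h1 := Real.rpow_nonneg (abs_nonneg y) p
  have h2 := Real.rpow_nonneg (abs_nonneg u) p
  have hm : ∀ x : ℝ, 0 ≤ x → x ^ (p - 1) * x = x ^ p := fun x hx => by
    have := sgnPow_mul_self h.pos.ne' x
    rwa [abs_of_nonneg hx, sgnPow_of_nonneg h.sub_one_pos.ne' hx] at this
  rw [hm _ ((abs_nonneg y).trans (le_max_left _ _))]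
  rcases max_choice |y| |u| with hc | hc <;> rw [hc] <;> linarith

/-- Every anti-periodic eigenfunction has a phase, advancing by an odd number of half periods. -/
theorem exists_phase_of_isAntiPeriodicEig (h : GenSine p S C) {q : ℝ → ℝ} {κ lam : ℝ} (hκ : 0 < κ)
    (hq : ∀ x y, IntervalIntegrable q volume x y) (heig : IsAntiPeriodicEig p q lam) :
    ∃ (ω : ℝ → ℝ) (k : ℤ),
      ACDeriv ω (fun t => κ + phaseCoeff p q κ lam t * |S (ω t)| ^ p) ∧
      ω 1 - ω 0 = (2 * k + 1) * pihat p := by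
  obtain ⟨y, hy, ⟨x₀, hx₀⟩, heq, hy01, hy01'⟩ := heig
  have hp := h.pos
  have hp1 := h.sub_one_pos
  set s : ℝ → ℝ := fun t => sgnPow (p - 1) (y t) with hs
  have hsc : Continuous s := (continuous_sgnPow hp1).comp hy.continuous
  have hWi : ∀ a b, IntervalIntegrable (fun t => -((p - 1) * (lam - q t) * s t)) volume a b :=
    fun a b => (((intervalIntegrable_const.sub (hq a b)).const_mul _).mul_continuousOn
      hsc.continuousOn).neg
  have hW : ACDeriv (fun t => sgnPow (p - 1) (deriv y t))
      (fun t => -((p - 1) * (lam - q t) * s t)) :=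
    .of_integral hWi fun a b => by rw [heq, intervalIntegral.integral_neg]
  have hvc : Continuous (deriv y) := by
    have : deriv y = fun t => sgnPow (1 / (p - 1)) (sgnPow (p - 1) (deriv y t)) :=
      funext fun t => (sgnPow_leftInverse hp1.ne' _).symm
    rw [this]
    exact (continuous_sgnPow (one_div_pos.2 hp1)).comp hW.continuous
  have hyd : ACDeriv y (deriv y) := .of_hasDerivAt (fun x => (hy x).hasDerivAt) hvc
  set b := phaseCoeff p q κ lam with hb
  have hbi := intervalIntegrable_phaseCoeff hq p κ lam
  set u : ℝ → ℝ := fun t => κ⁻¹ * deriv y t with hu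
  have huc : Continuous u := continuous_const.mul hvc
  have hv : ∀ t, deriv y t = κ * u t := fun t => by rw [hu]; field_simp
  have hκ1 := rpow_sub_one_mul_rpow_one_sub hκ p
  have hζ : ACDeriv (fun t => sgnPow (p - 1) (u t)) (fun t => -((p - 1) * (κ + b t) * s t)) :=
    (hW.const_mul (κ ^ (1 - p))).congr (fun t => by
      rw [hv, sgnPow_mul, sgnPow_of_pos _ hκ]
      linear_combination sgnPow (p - 1) (u t) * hκ1) fun t => by
      rw [hb, phaseCoeff]; ring
  have hconj : ∀ x : ℝ, |sgnPow (p - 1) x| ^ (p / (p - 1)) = |x| ^ p := h.abs_conj_rpow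
  have hr1 : 1 < p / (p - 1) := (one_lt_div hp1).2 (by linarith)
  have hr2 : p / (p - 1) - 1 = 1 / (p - 1) := by field_simp; ring
  set E : ℝ → ℝ := fun t => |y t| ^ p + |u t| ^ p with hE
  have hEc : Continuous E := ((_root_.continuous_abs_rpow hp.le).comp hy.continuous).add
    ((_root_.continuous_abs_rpow hp.le).comp huc)
  have hE0 : ∀ t, 0 ≤ E t := fun t => by positivity
  have hsu : ∀ t, |s t * u t| ≤ E t := fun t => h.abs_sgnPow_mul_le _ _
  set g : ℝ → ℝ := fun t => s t * u t / E t with hg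
  have hgE : ∀ t, g t * E t = s t * u t := fun t => by
    rcases eq_or_ne (E t) 0 with h0 | h0
    · have := hsu t
      rw [h0] at this ⊢
      rw [mul_zero, abs_nonpos_iff.1 this]
    · rw [hg]; field_simp
  have hg1 : ∀ t, ‖g t‖ ≤ 1 := fun t => by
    rw [hg, Real.norm_eq_abs, abs_div, abs_of_nonneg (hE0 t)]
    exact div_le_one_of_le₀ (hsu t) (hE0 t)
  have hgm : Measurable g := (hsc.mul huc).measurable.div hEc.measurable
  have hci : ∀ x y, IntervalIntegrable (fun t => -(b t * g t)) volume x y := fun x y =>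
    (intervalIntegrable_iff.2 ((intervalIntegrable_iff.1 (hbi x y)).mul_bdd
      hgm.aestronglyMeasurable (ae_of_all _ hg1))).neg
  have hEd : ACDeriv E (fun t => p * -(b t * g t) * E t) := by
    have h1 := hyd.comp (hasDerivAt_abs_rpow_sgnPow h.one_lt)
      (continuous_const.mul (continuous_sgnPow hp1))
    have h2 := hζ.comp (hasDerivAt_abs_rpow_sgnPow hr1)
      (continuous_const.mul (continuous_sgnPow (by linarith)))
    refine (h1.add h2).congr (fun t => by rw [hconj]) fun t => ?_
    rw [hr2, sgnPow_leftInverse hp1.ne', hv]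
    change p * s t * (κ * u t) + _ = _
    have := hgE t
    have h3 : p / (p - 1) * u t * -((p - 1) * (κ + b t) * s t) = -(p * u t * (κ + b t) * s t) := by
      field_simp
    rw [h3]
    linear_combination p * b t * hgE t
  have hci' : ∀ x y, IntervalIntegrable (fun t => p * -(b t * g t)) volume x y := fun x y =>
    (hci x y).const_mul p
  have hEeq := fun t => hEd.linear_homogeneous_eq hci' t
  have hE0pos : 0 < E 0 := by
    refine (hE0 0).lt_of_ne fun h0 => ?_
    have h1 := hEeq x₀
    rw [← h0, zero_mul] at h1
    have h2 : 0 < |y x₀| ^ p := Real.rpow_pos_of_pos (abs_pos.2 hx₀) p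
    have h3 : 0 ≤ |u x₀| ^ p := by positivity
    have h4 : |y x₀| ^ p + |u x₀| ^ p = 0 := h1
    linarith
  set e : ℝ → ℝ := fun t => Real.log (E 0) / p + ∫ x in (0:ℝ)..t, -(b x * g x) with he
  have hed : ACDeriv e (fun t => -(b t * g t)) :=
    ((ACDeriv.const _).add (.integral hci 0)).congr (fun _ => rfl) fun t => zero_add _
  have hEe : ∀ t, E t = Real.exp (p * e t) := fun t => by
    rw [hEeq, he]
    simp only
    rw [mul_add, Real.exp_add, mul_div_cancel₀ _ hp.ne', Real.exp_log hE0pos,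
      intervalIntegral.integral_const_mul]
  have hgE' : ∀ t, g t = s t * u t * Real.exp (-(p * e t)) := fun t => by
    have h1 := hgE t
    rw [hEe] at h1
    rw [← h1, mul_assoc, ← Real.exp_add]; simp
  have hEn : ∀ t, (|y t| ^ p + |u t| ^ p) * Real.exp (-(p * e t)) = 1 := fun t => by
    rw [show |y t| ^ p + |u t| ^ p = E t from rfl, hEe, ← Real.exp_add]; simp
  have hY0 := ((hed.const_mul (-1)).exp).mul hyd
  have hZ0 := ((hed.const_mul (-(p - 1))).exp).mul hζ
  have hYp : ∀ t, |Real.exp (-1 * e t) * y t| ^ p = Real.exp (-(p * e t)) * |y t| ^ p := fun t => by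
    rw [abs_mul, Real.mul_rpow (abs_nonneg _) (abs_nonneg _), Real.abs_exp, exp_rpow]
    ring_nf
  have hcirc : ∀ t, |Real.exp (-1 * e t) * y t| ^ p +
      |Real.exp (-(p - 1) * e t) * sgnPow (p - 1) (u t)| ^ (p / (p - 1)) = 1 := fun t => by
    rw [hYp, abs_mul, Real.mul_rpow (abs_nonneg _) (abs_nonneg _), Real.abs_exp, exp_rpow, hconj,
      show p / (p - 1) * (-(p - 1) * e t) = -(p * e t) by field_simp]
    linear_combination hEn t
  set m : ℝ → ℝ := fun t => κ + b t * |Real.exp (-1 * e t) * y t| ^ p with hm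
  have hsy : ∀ t, s t * y t = |y t| ^ p := fun t => sgnPow_mul_self hp.ne' _
  have huu : ∀ t, u t * sgnPow (p - 1) (u t) = |u t| ^ p := fun t => self_mul_sgnPow hp.ne' _
  have hY : ACDeriv (fun t => Real.exp (-1 * e t) * y t) (fun t => m t *
      sgnPow (1 / (p - 1)) (Real.exp (-(p - 1) * e t) * sgnPow (p - 1) (u t))) :=
    hY0.congr (fun _ => rfl) fun t => by
      rw [sgnPow_mul, sgnPow_leftInverse hp1.ne', sgnPow_exp,
        show 1 / (p - 1) * (-(p - 1) * e t) = -1 * e t by field_simp, hm]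
      simp only
      rw [hYp, hgE', hv]
      linear_combination Real.exp (-1 * e t) * b t * u t * Real.exp (-(p * e t)) * hsy t
  have hZ : ACDeriv (fun t => Real.exp (-(p - 1) * e t) * sgnPow (p - 1) (u t))
      (fun t => -(m t * ((p - 1) * sgnPow (p - 1) (Real.exp (-1 * e t) * y t)))) :=
    hZ0.congr (fun _ => rfl) fun t => by
      rw [sgnPow_mul (p - 1) (Real.exp (-1 * e t)) (y t), sgnPow_exp,
        show (p - 1) * (-1 * e t) = -(p - 1) * e t by ring, hm]
      simp only
      rw [hYp, hgE']
      change _ = -((κ + b t * (Real.exp (-(p * e t)) * |y t| ^ p)) *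
        ((p - 1) * (Real.exp (-(p - 1) * e t) * s t)))
      linear_combination (p - 1) * Real.exp (-(p - 1) * e t) * b t * s t *
        (hEn t + Real.exp (-(p * e t)) * huu t)
  have hmi : ∀ x y, IntervalIntegrable m volume x y := fun x y =>
    intervalIntegrable_const.add ((hbi x y).mul_continuousOn
      ((_root_.continuous_abs_rpow hp.le).comp hY.continuous).continuousOn)
  obtain ⟨φ, hφ, hφ'⟩ := h.exists_eq (hcirc 0)
  obtain ⟨ω, -, hω, hval⟩ := h.exists_lift hmi hY hZ hcirc hφ hφ'
  obtain ⟨-, -, -, hper, -⟩ := h.pihat_spec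
  have hyS : ∀ t, y t = Real.exp (e t) * S (ω t) := fun t => by
    rw [← (hval t).1, ← mul_assoc, ← Real.exp_add]; simp
  have huC : ∀ t, u t = Real.exp (e t) * C (ω t) := fun t => by
    refine sgnPow_injective hp1.ne' ?_
    rw [sgnPow_mul (p - 1) (Real.exp (e t)) (C (ω t)), ← (hval t).2, sgnPow_exp, ← mul_assoc,
      ← Real.exp_add, show (p - 1) * e t + -(p - 1) * e t = 0 by ring, Real.exp_zero, one_mul]
  have hu01 : u 0 = -u 1 := by simp only [hu, hy01', mul_neg]
  have he01 : e 0 = e 1 := by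
    have h1 : E 0 = E 1 := by simp only [hE, hy01, hu01, abs_neg]
    rw [hEe, hEe] at h1
    exact mul_left_cancel₀ hp.ne' (Real.exp_injective h1)
  have hpos := (Real.exp_pos (e 1)).ne'
  rw [hyS, hyS, he01] at hy01
  rw [huC, huC, he01] at hu01
  obtain ⟨k, hk⟩ := hper (ω 0) (ω 1)
    (mul_left_cancel₀ hpos (by linarith)) (mul_left_cancel₀ hpos (by linarith))
  refine ⟨ω, k, hω.congr (fun _ => rfl) fun t => ?_, hk⟩
  simp only [hm]
  rw [(hval t).1]

end GenSine

/-! ### Vanishing mean of the potential -/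

namespace GenSine

variable {p : ℝ} {S C : ℝ → ℝ}

theorem continuous_abs_rpow_deriv (h : GenSine p S C) :
    Continuous fun x => p * (sgnPow (p - 1) (S x) * C x) :=
  continuous_const.mul (((continuous_sgnPow h.sub_one_pos).comp h.continuous).mul
    h.continuous_deriv)

theorem abs_abs_rpow_deriv_le (h : GenSine p S C) (x : ℝ) :
    |p * (sgnPow (p - 1) (S x) * C x)| ≤ p := by
  rw [abs_mul, abs_mul, abs_of_pos h.pos]
  exact mul_le_of_le_one_right h.pos.le
    (mul_le_one₀ (h.abs_sgnPow_le_one x) (abs_nonneg _) (h.abs_deriv_le_one x))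

theorem abs_abs_rpow_le_one (h : GenSine p S C) (x : ℝ) : |(|S x| ^ p)| ≤ 1 := by
  rw [abs_of_nonneg (by positivity)]; exact h.abs_rpow_le_one x

theorem abs_abs_rpow_sub_le (h : GenSine p S C) (x y : ℝ) :
    |(|S x| ^ p - |S y| ^ p)| ≤ p * |x - y| := by
  rw [sub_eq_avgDeriv_mul h.hasDerivAt_abs_rpow h.continuous_abs_rpow_deriv x y, abs_mul]
  gcongr
  exact abs_avgDeriv_le h.abs_abs_rpow_deriv_le x y

theorem hasDerivAt_mul_conj (h : GenSine p S C) (x : ℝ) :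
    HasDerivAt (fun t => S t * sgnPow (p - 1) (C t)) (1 - p * |S x| ^ p) x := by
  refine ((h.hasDerivAt x).mul (h.hasDerivAt_sgnPow x)).congr_deriv ?_
  have h1 := self_mul_sgnPow h.pos.ne' (C x)
  have h2 := self_mul_sgnPow h.pos.ne' (S x)
  linear_combination h1 - (p - 1) * h2 + h.pythagoras x

theorem abs_mul_conj_le_one (h : GenSine p S C) (x : ℝ) :
    |S x * sgnPow (p - 1) (C x)| ≤ 1 := by
  rw [abs_mul]
  exact mul_le_one₀ (h.abs_le_one x) (abs_nonneg _) (h.abs_conj_le_one x)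

/-- A Riemann–Lebesgue lemma for the oscillation of `|S|^p` around its mean. -/
theorem riemann_lebesgue (h : GenSine p S C) {q : ℝ → ℝ}
    (hq : ∀ x y, IntervalIntegrable q volume x y) {ε : ℝ} (hε : 0 < ε) :
    ∃ K : ℝ, ∀ κ : ℝ, K ≤ κ → ∀ φ : ℝ,
      |∫ t in (0:ℝ)..1, q t * (|S (φ + κ * t)| ^ p - 1 / p)| ≤ ε := by
  have hp := h.pos
  obtain ⟨g, -, hg, hqg⟩ : ∃ g : ℝ → ℝ, HasCompactSupport g ∧ ContDiff ℝ ((⊤ : ℕ∞) : WithTop ℕ∞) g ∧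
      ∫ t in (0:ℝ)..1, |q t - g t| ≤ ε / 2 := by
    obtain ⟨g, hg1, hg, hqg⟩ := MemLp.exist_eLpNorm_sub_le (p := 1) (by simp) le_rfl
      (memLp_one_iff_integrable.2 (hq 0 1).1) (half_pos hε)
    refine ⟨g, hg1, hg, ?_⟩
    rw [intervalIntegral.integral_of_le zero_le_one]
    have hi : Integrable (q - g) (volume.restrict (Ioc (0:ℝ) 1)) :=
      (hq 0 1).1.sub (hg.continuous.intervalIntegrable 0 1).1
    rw [eLpNorm_one_eq_lintegral_enorm, ← ofReal_integral_norm_eq_lintegral_enorm hi,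
      ENNReal.ofReal_le_ofReal_iff (half_pos hε).le] at hqg
    exact hqg
  have hgd : ∀ x, HasDerivAt g (deriv g x) x := fun x =>
    (hg.differentiable (by simp) x).hasDerivAt
  have hgc : Continuous (deriv g) := hg.continuous_deriv (by simp)
  set P : ℝ → ℝ := fun t => S t * sgnPow (p - 1) (C t)
  set M := |g 1| + |g 0| + ∫ t in (0:ℝ)..1, |deriv g t| with hM
  have hM0 : 0 ≤ M := by
    have : 0 ≤ ∫ t in (0:ℝ)..1, |deriv g t| :=
      intervalIntegral.integral_nonneg zero_le_one fun _ _ => abs_nonneg _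
    positivity
  refine ⟨2 * M / (ε * p) + 1, fun κ hκ φ => ?_⟩
  have hκ0 : 0 < κ := lt_of_lt_of_le (by positivity) hκ
  set Q : ℝ → ℝ := fun t => |S (φ + κ * t)| ^ p - 1 / p with hQ
  have hQc : Continuous Q := (h.continuous_abs_rpow.comp (by fun_prop)).sub continuous_const
  have hQ1 : ∀ t, |Q t| ≤ 1 := fun t => by
    have h1 := h.abs_rpow_le_one (φ + κ * t)
    have h2 : 0 ≤ |S (φ + κ * t)| ^ p := by positivity
    have h3 : 1 / p ≤ 1 := (div_le_one hp).2 h.one_lt.le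
    have h4 : 0 < 1 / p := by positivity
    rw [abs_le, hQ]
    constructor <;> linarith
  have hPd : ∀ t, HasDerivAt (fun t => P (φ + κ * t)) (-(p * κ) * Q t) t := fun t => by
    refine ((h.hasDerivAt_mul_conj _).comp t
      (((hasDerivAt_id t).const_mul κ).const_add φ)).congr_deriv ?_
    have h1 : p * (1 / p) = 1 := mul_one_div_cancel hp.ne'
    change (1 - p * |S (φ + κ * t)| ^ p) * (κ * 1) = -(p * κ) * (|S (φ + κ * t)| ^ p - 1 / p)
    linear_combination -κ * h1
  have hPc : Continuous fun t => P (φ + κ * t) :=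
    continuous_iff_continuousAt.2 fun t => (hPd t).continuousAt
  have hparts := intervalIntegral.integral_mul_deriv_eq_deriv_mul (a := 0) (b := 1)
    (fun x _ => hgd x) (fun x _ => hPd x) (hgc.intervalIntegrable 0 1)
    ((continuous_const.mul hQc).intervalIntegrable 0 1)
  have hP1 : ∀ x, |P x| ≤ 1 := h.abs_mul_conj_le_one
  have hbd : |∫ t in (0:ℝ)..1, deriv g t * P (φ + κ * t)| ≤ ∫ t in (0:ℝ)..1, |deriv g t| := by
    refine (intervalIntegral.abs_integral_le_integral_abs zero_le_one).trans ?_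
    refine intervalIntegral.integral_mono_on zero_le_one
      ((hgc.mul hPc).abs.intervalIntegrable 0 1) (hgc.abs.intervalIntegrable 0 1) fun t _ => ?_
    rw [abs_mul]
    exact mul_le_of_le_one_right (abs_nonneg _) (hP1 _)
  have hg2 : |∫ t in (0:ℝ)..1, g t * Q t| ≤ ε / 2 := by
    have h1 : ∫ t in (0:ℝ)..1, g t * (-(p * κ) * Q t) =
        -(p * κ) * ∫ t in (0:ℝ)..1, g t * Q t := by
      rw [← intervalIntegral.integral_const_mul]; congr 1; ext t; ring
    rw [h1] at hparts
    have h2 : p * κ * |∫ t in (0:ℝ)..1, g t * Q t| ≤ M := by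
      calc p * κ * |∫ t in (0:ℝ)..1, g t * Q t| = |-(p * κ) * ∫ t in (0:ℝ)..1, g t * Q t| := by
            rw [abs_mul, abs_neg, abs_of_pos (mul_pos hp hκ0)]
        _ ≤ |g 1 * P (φ + κ * 1)| + |g 0 * P (φ + κ * 0)| +
              |∫ t in (0:ℝ)..1, deriv g t * P (φ + κ * t)| := by
            rw [hparts]
            exact (abs_sub _ _).trans (add_le_add_left (abs_sub _ _) _)
        _ ≤ M := by
            rw [abs_mul (g 1), abs_mul (g 0)]
            have h3 := mul_le_of_le_one_right (abs_nonneg (g 1)) (hP1 (φ + κ * 1))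
            have h4 := mul_le_of_le_one_right (abs_nonneg (g 0)) (hP1 (φ + κ * 0))
            linarith
    have h3 : M ≤ p * κ * (ε / 2) := by
      have h4 : 2 * M / (ε * p) ≤ κ := by linarith
      rw [div_le_iff₀ (by positivity)] at h4
      linarith
    exact le_of_mul_le_mul_left (h2.trans h3) (mul_pos hp hκ0)
  have hsplit : ∫ t in (0:ℝ)..1, q t * Q t =
      (∫ t in (0:ℝ)..1, (q t - g t) * Q t) + ∫ t in (0:ℝ)..1, g t * Q t := by
    rw [← intervalIntegral.integral_add]
    · congr 1; ext t; ring
    · exact ((hq 0 1).sub (hg.continuous.intervalIntegrable 0 1)).mul_continuousOn hQc.continuousOn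
    · exact (hg.continuous.mul hQc).intervalIntegrable 0 1
  have hdiff : |∫ t in (0:ℝ)..1, (q t - g t) * Q t| ≤ ε / 2 := by
    refine ((intervalIntegral.abs_integral_le_integral_abs zero_le_one).trans ?_).trans hqg
    have hi := (hq 0 1).sub (hg.continuous.intervalIntegrable 0 1)
    refine intervalIntegral.integral_mono_on zero_le_one
      (hi.mul_continuousOn hQc.continuousOn).abs hi.abs fun t _ => ?_
    rw [abs_mul]
    exact mul_le_of_le_one_right (abs_nonneg _) (hQ1 _)
  rw [hsplit]
  exact (abs_add_le _ _).trans (by linarith)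

theorem abs_integral_mul_le {f g : ℝ → ℝ} {c : ℝ} (hf : IntervalIntegrable f volume 0 1)
    (hg : Continuous g) (hc : ∀ t ∈ Icc (0:ℝ) 1, |g t| ≤ c) {s : ℝ} (hs : s ∈ Icc (0:ℝ) 1) :
    |∫ t in (0:ℝ)..s, f t * g t| ≤ c * ∫ t in (0:ℝ)..1, |f t| := by
  have hsub : uIcc 0 s ⊆ uIcc (0:ℝ) 1 := by
    rw [uIcc_of_le hs.1, uIcc_of_le zero_le_one]; exact Icc_subset_Icc_right hs.2
  have hf' := hf.mono_set hsub
  calc |∫ t in (0:ℝ)..s, f t * g t| ≤ ∫ t in (0:ℝ)..s, |f t * g t| :=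
        intervalIntegral.abs_integral_le_integral_abs hs.1
    _ ≤ ∫ t in (0:ℝ)..s, c * |f t| := by
        refine intervalIntegral.integral_mono_on hs.1 (hf'.mul_continuousOn hg.continuousOn).abs
          (hf'.abs.const_mul c) fun t ht => ?_
        rw [abs_mul, mul_comm]
        exact mul_le_mul_of_nonneg_right (hc t ⟨ht.1, ht.2.trans hs.2⟩) (abs_nonneg _)
    _ = c * ∫ t in (0:ℝ)..s, |f t| := intervalIntegral.integral_const_mul _ _
    _ ≤ c * ∫ t in (0:ℝ)..1, |f t| := by
        refine mul_le_mul_of_nonneg_left ?_ ((abs_nonneg _).trans (hc 0 (by simp)))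
        exact intervalIntegral.integral_mono_interval le_rfl hs.1 hs.2
          (ae_of_all _ fun _ => abs_nonneg _) hf.abs

theorem phaseCoeff_rpow_self {q : ℝ → ℝ} {κ : ℝ} (hκ : 0 < κ) (t : ℝ) :
    phaseCoeff p q κ (κ ^ p) t = -(κ ^ (1 - p) * q t) := by
  have : κ ^ (1 - p) * κ ^ p = κ := by rw [← Real.rpow_add hκ]; simp
  rw [phaseCoeff, mul_sub, this]; ring

theorem exists_abs_integral_le (h : GenSine p S C) {q : ℝ → ℝ}
    (hq : ∀ x y, IntervalIntegrable q volume x y) {κ : ℝ} (hκ : 0 < κ) {n : ℤ}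
    (hn : κ = (2 * n + 1) * pihat p) (heig : IsAntiPeriodicEig p q (κ ^ p))
    (hsmall : κ ^ (1 - p) * (∫ t in (0:ℝ)..1, |q t|) < 2 * pihat p) :
    ∃ φ, |∫ t in (0:ℝ)..1, q t * |S (φ + κ * t)| ^ p| ≤
      p * (κ ^ (1 - p) * ∫ t in (0:ℝ)..1, |q t|) * ∫ t in (0:ℝ)..1, |q t| := by
  obtain ⟨ω, k, hω, hk⟩ := h.exists_phase_of_isAntiPeriodicEig hκ hq heig
  obtain ⟨hT, -, -, -, -⟩ := h.pihat_spec
  simp only [phaseCoeff_rpow_self hκ] at hω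
  have hG : Continuous fun t => |S (ω t)| ^ p := h.continuous_abs_rpow.comp hω.continuous
  have hc0 : 0 < κ ^ (1 - p) := Real.rpow_pos_of_pos hκ _
  have h_int : ∀ s, ω s - (ω 0 + κ * s) = -(κ ^ (1 - p) *
      ∫ t in (0:ℝ)..s, q t * |S (ω t)| ^ p) := fun s => by
    have h1 : ∀ t, κ + -(κ ^ (1 - p) * q t) * |S (ω t)| ^ p =
        κ - κ ^ (1 - p) * (q t * |S (ω t)| ^ p) := fun t => by ring
    rw [hω.eq_add_integral s]
    simp only [h1]
    rw [intervalIntegral.integral_sub intervalIntegrable_const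
      (((hq 0 s).mul_continuousOn hG.continuousOn).const_mul _),
      intervalIntegral.integral_const_mul, intervalIntegral.integral_const, smul_eq_mul]
    ring
  have hdist : ∀ s ∈ Icc (0:ℝ) 1, |ω s - (ω 0 + κ * s)| ≤
      κ ^ (1 - p) * ∫ t in (0:ℝ)..1, |q t| := fun s hs => by
    rw [h_int, abs_neg, abs_mul, abs_of_pos hc0]
    gcongr
    simpa using abs_integral_mul_le (hq 0 1) hG (fun t _ => h.abs_abs_rpow_le_one _) hs
  have hkn : k = n := by
    have h1 := (hdist 1 (by simp)).trans_lt hsmall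
    rw [show ω 1 - (ω 0 + κ * 1) = (2 * ((k - n : ℤ) : ℝ)) * pihat p by
      push_cast; rw [hn]; linear_combination hk, abs_mul, abs_mul, abs_of_pos hT, abs_two] at h1
    have h2 : |((k - n : ℤ) : ℝ)| < 1 := by nlinarith
    rw [← Int.cast_abs] at h2
    have h3 : |k - n| < 1 := by exact_mod_cast h2
    rw [Int.abs_lt_one_iff] at h3
    omega
  have hzero : ∫ t in (0:ℝ)..1, q t * |S (ω t)| ^ p = 0 := by
    have h1 := h_int 1
    rw [show ω 1 - (ω 0 + κ * 1) = 0 by rw [hkn] at hk; rw [hn]; linear_combination hk] at h1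
    simpa [hc0.ne'] using h1.symm
  refine ⟨ω 0, ?_⟩
  have hL : Continuous fun t => |S (ω 0 + κ * t)| ^ p :=
    h.continuous_abs_rpow.comp (by fun_prop)
  have h1 : ∫ t in (0:ℝ)..1, q t * |S (ω 0 + κ * t)| ^ p =
      ∫ t in (0:ℝ)..1, q t * (|S (ω 0 + κ * t)| ^ p - |S (ω t)| ^ p) := by
    simp only [mul_sub]
    rw [intervalIntegral.integral_sub ((hq 0 1).mul_continuousOn hL.continuousOn)
        ((hq 0 1).mul_continuousOn hG.continuousOn), hzero, sub_zero]
  rw [h1]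
  refine abs_integral_mul_le (hq 0 1) (hL.sub hG) (fun t ht => ?_) (by simp)
  refine (h.abs_abs_rpow_sub_le _ _).trans ?_
  rw [abs_sub_comm]
  exact mul_le_mul_of_nonneg_left (hdist t ht) h.pos.le

theorem tendsto_rpow_one_sub (h : GenSine p S C) (M : ℝ) :
    Tendsto (fun κ : ℝ => κ ^ (1 - p) * M) atTop (𝓝 0) := by
  have := (tendsto_rpow_neg_atTop h.sub_one_pos).mul_const M
  simpa using this

theorem integral_eq_zero (h : GenSine p S C) {q : ℝ → ℝ}
    (hq : ∀ x y, IntervalIntegrable q volume x y)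
    (hspec : ∀ n : ℕ, 1 ≤ n → IsAntiPeriodicEig p q (((2 * n - 1) * pihat p) ^ p)) :
    ∫ t in (0:ℝ)..1, q t = 0 := by
  obtain ⟨hT, -, -, -, -⟩ := h.pihat_spec
  have hp := h.pos
  set M := ∫ t in (0:ℝ)..1, |q t| with hM
  refine abs_nonpos_iff.1 (le_of_forall_pos_le_add fun ε hε => ?_)
  have hε' : 0 < ε / (2 * p) := by positivity
  obtain ⟨K, hK⟩ := h.riemann_lebesgue hq hε'
  have h1 := h.tendsto_rpow_one_sub M
  have h2 : Tendsto (fun κ : ℝ => p * (κ ^ (1 - p) * M) * M) atTop (𝓝 0) := by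
    simpa using (h1.const_mul p).mul_const M
  have hκt : Tendsto (fun n : ℕ => (2 * (n:ℝ) + -1) * pihat p) atTop atTop :=
    (tendsto_atTop_add_const_right _ _
      (tendsto_natCast_atTop_atTop.const_mul_atTop zero_lt_two)).atTop_mul_const hT
  obtain ⟨n, ⟨hn1, hn0, hn2, hn3⟩, hn⟩ := ((hκt.eventually ((eventually_ge_atTop K).and
    ((eventually_gt_atTop 0).and ((h1.eventually_lt_const (by positivity : 0 < 2 * pihat p)).and
      (h2.eventually_lt_const hε'))))).and (eventually_ge_atTop 1)).exists
  set κ := (2 * (n:ℝ) + -1) * pihat p with hκ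
  have heig : IsAntiPeriodicEig p q (κ ^ p) := by
    have := hspec n hn
    rwa [sub_eq_add_neg] at this
  obtain ⟨φ, hφ⟩ := h.exists_abs_integral_le hq hn0 (n := (n:ℤ) - 1)
    (by rw [hκ]; push_cast; ring) heig hn2
  have h3 := hK κ hn1 φ
  have hL : Continuous fun t => |S (φ + κ * t)| ^ p :=
    h.continuous_abs_rpow.comp (by fun_prop)
  have h4 : ∫ t in (0:ℝ)..1, q t * (|S (φ + κ * t)| ^ p - 1 / p) =
      (∫ t in (0:ℝ)..1, q t * |S (φ + κ * t)| ^ p) - (∫ t in (0:ℝ)..1, q t) * (1 / p) := by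
    rw [← intervalIntegral.integral_mul_const,
      ← intervalIntegral.integral_sub ((hq 0 1).mul_continuousOn hL.continuousOn)
        ((hq 0 1).mul_const _)]
    simp only [mul_sub]
  rw [h4] at h3
  have h5 : |(∫ t in (0:ℝ)..1, q t) * (1 / p)| ≤ ε / p := by
    have h6 := abs_sub_abs_le_abs_sub ((∫ t in (0:ℝ)..1, q t) * (1 / p))
      (∫ t in (0:ℝ)..1, q t * |S (φ + κ * t)| ^ p)
    rw [abs_sub_comm] at h3
    have h7 : ε / (2 * p) + ε / (2 * p) = ε / p := by field_simp; ring
    linarith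
  rw [abs_mul, abs_of_pos (by positivity : 0 < 1 / p), mul_one_div, div_le_div_iff_of_pos_right hp]
    at h5
  linarith

end GenSine

/-! ### Advance of the phase below the least eigenvalue -/

namespace GenSine

variable {p : ℝ} {S C : ℝ → ℝ}

theorem periodic_abs_rpow (h : GenSine p S C) : Function.Periodic (fun x => |S x| ^ p) (pihat p) :=
  fun x => by
    obtain ⟨-, hshift, -, -, -⟩ := h.pihat_spec
    simp only [(hshift x).1, abs_neg]

/-- A bump detecting the part of the half period where the amplitude is large. -/
theorem continuous_bump (h : GenSine p S C) : Continuous fun x => max (2 * |S x| ^ p - 1) 0 :=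
  ((continuous_const.mul h.continuous_abs_rpow).sub continuous_const).max continuous_const

theorem integral_bump_pos (h : GenSine p S C) :
    0 < ∫ x in (0:ℝ)..pihat p, max (2 * |S x| ^ p - 1) 0 := by
  obtain ⟨hT, -, -, -, m, hm, hCm⟩ := h.pihat_spec
  refine intervalIntegral.integral_pos hT h.continuous_bump.continuousOn
    (fun _ _ => le_max_right _ _) ⟨m, ⟨hm.1.le, hm.2.le⟩, lt_max_of_lt_left ?_⟩
  have := h.pythagoras m
  rw [hCm, abs_zero, Real.zero_rpow h.pos.ne', add_zero] at this
  rw [this]; norm_num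

/-- For a very negative spectral parameter the phase advances by less than a half period. -/
theorem phase_sub_lt_of_eq_neg (h : GenSine p S C) {q θ : ℝ → ℝ}
    (hq : ∀ x y, IntervalIntegrable q volume x y) {κ : ℝ} (hκ : 0 < κ)
    (hsmall : κ ^ (1 - p) * (∫ t in (0:ℝ)..1, |q t|) <
      ∫ x in (0:ℝ)..pihat p, max (2 * |S x| ^ p - 1) 0)
    (hθ : ACDeriv θ fun t => κ + phaseCoeff p q κ (-κ ^ p) t * |S (θ t)| ^ p) :
    θ 1 - θ 0 < pihat p := by
  set η : ℝ → ℝ := fun x => max (2 * |S x| ^ p - 1) 0 with hη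
  have hηc : Continuous η := h.continuous_bump
  have hηi := fun a b => hηc.intervalIntegrable (μ := volume) a b
  have hη0 : ∀ x, 0 ≤ η x := fun x => le_max_right _ _
  have hη1 : ∀ x, η x ≤ 1 := fun x => max_le (by linarith [h.abs_rpow_le_one x]) zero_le_one
  have hκ0 : 0 < κ ^ (1 - p) := Real.rpow_pos_of_pos hκ _
  have hd := hθ.comp (F := fun x => ∫ s in (0:ℝ)..x, η s) (F' := η)
    (fun x => (hηc.integral_hasStrictDerivAt 0 x).hasDerivAt) hηc
  have hle : ∀ t, η (θ t) * (κ + phaseCoeff p q κ (-κ ^ p) t * |S (θ t)| ^ p) ≤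
      κ ^ (1 - p) * |q t| := fun t => by
    have h1 : κ ^ (1 - p) * κ ^ p = κ := by rw [← Real.rpow_add hκ]; simp
    have h2 : η (θ t) * (κ + phaseCoeff p q κ (-κ ^ p) t * |S (θ t)| ^ p) =
        -(κ * (η (θ t) * (2 * |S (θ t)| ^ p - 1))) +
          κ ^ (1 - p) * (η (θ t) * |S (θ t)| ^ p * (-q t)) := by
      rw [phaseCoeff]
      linear_combination -η (θ t) * |S (θ t)| ^ p * h1
    have h3 : 0 ≤ η (θ t) * (2 * |S (θ t)| ^ p - 1) := by
      rcases le_total 0 (2 * |S (θ t)| ^ p - 1) with h4 | h4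
      · exact mul_nonneg (hη0 _) h4
      · have : η (θ t) = 0 := max_eq_right h4
        rw [this, zero_mul]
    have h4 : η (θ t) * |S (θ t)| ^ p * (-q t) ≤ |q t| := by
      have h5 : 0 ≤ |S (θ t)| ^ p := by positivity
      have h6 : η (θ t) * |S (θ t)| ^ p ≤ 1 := mul_le_one₀ (hη1 _) h5 (h.abs_rpow_le_one _)
      calc η (θ t) * |S (θ t)| ^ p * (-q t) ≤ η (θ t) * |S (θ t)| ^ p * |q t| :=
            mul_le_mul_of_nonneg_left (neg_le_abs _) (mul_nonneg (hη0 _) h5)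
        _ ≤ |q t| := mul_le_of_le_one_left (abs_nonneg _) h6
    rw [h2]
    nlinarith [mul_nonneg hκ.le h3, mul_le_mul_of_nonneg_left h4 hκ0.le]
  by_contra! hT
  have h1 : ∫ s in (θ 0)..(θ 1), η s ≤ κ ^ (1 - p) * ∫ t in (0:ℝ)..1, |q t| := by
    rw [intervalIntegral.integral_interval_sub_left (hηi 0 _) (hηi 0 _) |>.symm,
      ← hd.integral_eq_sub, ← intervalIntegral.integral_const_mul]
    exact intervalIntegral.integral_mono_on zero_le_one (hd.intervalIntegrable 0 1)
      ((hq 0 1).abs.const_mul _) fun t _ => hle t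
  have h2 : ∫ x in (0:ℝ)..pihat p, η x ≤ ∫ s in (θ 0)..(θ 1), η s := by
    have hper : Function.Periodic η (pihat p) := fun x => by
      have := h.periodic_abs_rpow x
      simp only at this
      simp only [hη, this]
    have h3 := hper.intervalIntegral_add_eq 0 (θ 0)
    rw [zero_add] at h3
    rw [h3, ← intervalIntegral.integral_add_adjacent_intervals (hηi (θ 0) (θ 0 + pihat p))
      (hηi _ (θ 1))]
    have h4 : θ 0 + pihat p ≤ θ 1 := by linarith
    exact le_add_of_nonneg_right (intervalIntegral.integral_nonneg h4 fun x _ => hη0 x)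
  linarith

theorem exists_phase (h : GenSine p S C) {q : ℝ → ℝ}
    (hq : ∀ x y, IntervalIntegrable q volume x y) (κ lam φ : ℝ) : ∃ θ : ℝ → ℝ, θ 0 = φ ∧
      ACDeriv θ fun t => κ + phaseCoeff p q κ lam t * |S (θ t)| ^ p :=
  _root_.exists_phase h.pos h.abs_abs_rpow_sub_le h.abs_abs_rpow_le_one
    (intervalIntegrable_phaseCoeff hq p κ lam) κ φ

theorem continuous_phase (h : GenSine p S C) {q : ℝ → ℝ}
    (hq : ∀ x y, IntervalIntegrable q volume x y) {κ : ℝ} {Θ : ℝ → ℝ → ℝ → ℝ}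
    (hΘ0 : ∀ lam φ, Θ lam φ 0 = φ)
    (hΘ : ∀ lam φ, ACDeriv (Θ lam φ) fun t =>
      κ + phaseCoeff p q κ lam t * |S (Θ lam φ t)| ^ p) {t : ℝ} (ht : t ∈ Icc (0:ℝ) 1) :
    Continuous fun z : ℝ × ℝ => Θ z.1 z.2 t := by
  rw [continuous_iff_continuousAt]
  rintro ⟨lam, φ⟩
  set D := Real.exp (2 * (p * ∫ s in (0:ℝ)..1, |phaseCoeff p q κ lam s|))
  have hle : ∀ z : ℝ × ℝ, dist (Θ z.1 z.2 t) (Θ lam φ t) ≤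
      D * (|φ - z.2| + |κ ^ (1 - p) * (lam - z.1)|) := fun z => by
    rw [dist_comm, Real.dist_eq]
    have := abs_phase_sub_le h.hasDerivAt_abs_rpow h.continuous_abs_rpow_deriv
      h.abs_abs_rpow_deriv_le h.abs_abs_rpow_le_one (intervalIntegrable_phaseCoeff hq p κ lam)
      (b₂ := phaseCoeff p q κ z.1) (c := κ ^ (1 - p) * (lam - z.1))
      (fun t => by rw [phaseCoeff, phaseCoeff]; ring) (hΘ lam φ) (hΘ z.1 z.2) ht
    rwa [hΘ0, hΘ0] at this
  refine tendsto_iff_dist_tendsto_zero.2 (squeeze_zero (fun _ => dist_nonneg) hle ?_)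
  have hc : Continuous fun z : ℝ × ℝ => D * (|φ - z.2| + |κ ^ (1 - p) * (lam - z.1)|) := by
    fun_prop
  simpa using hc.tendsto (lam, φ)

theorem phase_add_pihat (h : GenSine p S C) {q θ₁ θ₂ : ℝ → ℝ}
    (hq : ∀ x y, IntervalIntegrable q volume x y) {κ lam : ℝ}
    (h₁ : ACDeriv θ₁ fun t => κ + phaseCoeff p q κ lam t * |S (θ₁ t)| ^ p)
    (h₂ : ACDeriv θ₂ fun t => κ + phaseCoeff p q κ lam t * |S (θ₂ t)| ^ p)
    (h0 : θ₂ 0 = θ₁ 0 + pihat p) (t : ℝ) : θ₂ t = θ₁ t + pihat p := by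
  refine phase_unique h.hasDerivAt_abs_rpow h.continuous_abs_rpow_deriv
    (intervalIntegrable_phaseCoeff hq p κ lam) (θ₂ := fun t => θ₁ t + pihat p) h₂ ?_ h0 t
  refine (h₁.add (.const (pihat p))).congr (fun _ => rfl) fun t => ?_
  have := h.periodic_abs_rpow (θ₁ t)
  simp only at this
  rw [this, add_zero]

/-- Where the advance of the phase is maximal, its linearization is balanced. -/
theorem integral_eq_zero_of_forall_phase_le (h : GenSine p S C) {b : ℝ → ℝ}
    (hb : ∀ x y, IntervalIntegrable b volume x y) {κ φ₀ : ℝ} {Θ : ℝ → ℝ → ℝ}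
    (hΘ0 : ∀ φ, Θ φ 0 = φ) (hΘ : ∀ φ, ACDeriv (Θ φ) fun t => κ + b t * |S (Θ φ t)| ^ p)
    (hΘc : ∀ t ∈ Icc (0:ℝ) 1, Continuous fun φ => Θ φ t)
    (hmax : ∀ φ, Θ φ 1 - φ ≤ Θ φ₀ 1 - φ₀) :
    ∫ t in (0:ℝ)..1, b t * (p * (sgnPow (p - 1) (S (Θ φ₀ t)) * C (Θ φ₀ t))) = 0 := by
  set G' : ℝ → ℝ := fun x => p * (sgnPow (p - 1) (S x) * C x) with hG'
  have hG'c : Continuous G' := h.continuous_abs_rpow_deriv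
  set I : ℝ → ℝ := fun φ => ∫ t in (0:ℝ)..1, b t * avgDeriv G' (Θ φ t) (Θ φ₀ t) with hI
  have hIφ : I φ₀ = ∫ t in (0:ℝ)..1, b t * G' (Θ φ₀ t) := by simp only [hI, avgDeriv_self]
  have hIc : ContinuousAt I φ₀ := by
    refine intervalIntegral.continuousAt_of_dominated_interval (bound := fun t => |b t| * p)
      (Eventually.of_forall fun φ => ?_) (Eventually.of_forall fun φ => ae_of_all _ fun t _ => ?_)
      ((hb 0 1).abs.mul_const p) (ae_of_all _ fun t ht => ?_)
    · exact (intervalIntegrable_mul_avgDeriv hG'c hb (hΘ φ).continuous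
        (hΘ φ₀).continuous 0 1).def'.aestronglyMeasurable
    · rw [Real.norm_eq_abs, abs_mul]
      exact mul_le_mul_of_nonneg_left (abs_avgDeriv_le h.abs_abs_rpow_deriv_le _ _) (abs_nonneg _)
    · rw [uIoc_of_le zero_le_one] at ht
      have := (continuous_avgDeriv hG'c).comp
        ((hΘc t ⟨ht.1.le, ht.2⟩).prodMk (continuous_const (y := Θ φ₀ t)))
      exact (continuous_const.mul this).continuousAt
  have hsign : ∀ φ, (φ - φ₀) * (Real.exp (I φ) - 1) ≤ 0 := fun φ => by
    have h1 := phase_sub_eq h.hasDerivAt_abs_rpow hG'c hb (hΘ φ) (hΘ φ₀) 1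
    rw [hΘ0, hΘ0] at h1
    have h2 := hmax φ
    have h3 : (φ - φ₀) * Real.exp (I φ) = Θ φ 1 - Θ φ₀ 1 := h1.symm
    linarith
  rw [← hIφ]
  refine le_antisymm ?_ ?_
  · refine le_of_tendsto (hIc.tendsto.mono_left (nhdsWithin_le_nhds (s := Ioi φ₀)))
      (eventually_mem_nhdsWithin.mono fun φ hφ => ?_)
    have h1 := hsign φ
    by_contra! h2
    have := mul_pos (sub_pos.2 hφ) (sub_pos.2 (Real.one_lt_exp_iff.2 h2))
    linarith
  · refine ge_of_tendsto (hIc.tendsto.mono_left (nhdsWithin_le_nhds (s := Iio φ₀)))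
      (eventually_mem_nhdsWithin.mono fun φ hφ => ?_)
    have h1 := hsign φ
    by_contra! h2
    have := mul_pos_of_neg_of_neg (sub_neg.2 hφ) (sub_neg.2 (Real.exp_lt_one_iff.2 h2))
    linarith

/-- If no eigenvalue lies below `π̂^p`, then for spectral parameters below `π̂^p` the phase advances
by less than a half period. -/
theorem phase_sub_lt_of_forall_le (h : GenSine p S C) {q θ : ℝ → ℝ}
    (hq : ∀ x y, IntervalIntegrable q volume x y) {κ lam : ℝ} (hκ : 0 < κ)
    (hsmall : κ ^ (1 - p) * (∫ t in (0:ℝ)..1, |q t|) <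
      ∫ x in (0:ℝ)..pihat p, max (2 * |S x| ^ p - 1) 0)
    (hleast : ∀ lam : ℝ, IsAntiPeriodicEig p q lam → pihat p ^ p ≤ lam)
    (hlam0 : 0 ≤ lam) (hlam : lam < pihat p ^ p)
    (hθ : ACDeriv θ fun t => κ + phaseCoeff p q κ lam t * |S (θ t)| ^ p) :
    θ 1 - θ 0 < pihat p := by
  obtain ⟨hT, -, -, -, -⟩ := h.pihat_spec
  choose Θ hΘ0 hΘ using fun lam φ => h.exists_phase hq κ lam φ
  have hone : (1:ℝ) ∈ Icc (0:ℝ) 1 := by simp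
  have hcont : ∀ t ∈ Icc (0:ℝ) 1, Continuous fun z : ℝ × ℝ => Θ z.1 z.2 t := fun t ht =>
    h.continuous_phase hq hΘ0 hΘ ht
  set A : ℝ → ℝ → ℝ := fun lam φ => Θ lam φ 1 - φ with hA
  have hAc : Continuous (Function.uncurry A) := (hcont 1 hone).sub continuous_snd
  have hAper : ∀ lam, Function.Periodic (A lam) (pihat p) := fun lam φ => by
    have := h.phase_add_pihat hq (hΘ lam φ) (hΘ lam (φ + pihat p)) (by rw [hΘ0, hΘ0]) 1
    simp only [hA, this]; ring
  have hK : IsCompact (Icc 0 (pihat p)) := isCompact_Icc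
  set m : ℝ → ℝ := fun lam => sSup (A lam '' Icc 0 (pihat p)) with hm
  have hmc : Continuous m := hK.continuous_sSup hAc
  have hmax : ∀ lam, ∃ φ, A lam φ = m lam ∧ ∀ ψ, A lam ψ ≤ m lam := fun lam => by
    obtain ⟨φ, -, hφ, hle⟩ := hK.exists_sSup_image_eq_and_ge (nonempty_Icc.2 hT.le)
      (f := A lam) (hAc.comp (Continuous.prodMk_right lam)).continuousOn
    refine ⟨φ, hφ.symm, fun ψ => ?_⟩
    obtain ⟨ψ', hψ', he⟩ := (hAper lam).exists_mem_Ico₀ hT ψ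
    rw [he]
    refine le_trans ?_ hφ.ge
    exact hle ψ' ⟨hψ'.1, hψ'.2.le⟩
  have hlow : m (-κ ^ p) < pihat p := by
    obtain ⟨φ, hφ, -⟩ := hmax (-κ ^ p)
    have := h.phase_sub_lt_of_eq_neg hq hκ hsmall (hΘ (-κ ^ p) φ)
    rw [hΘ0] at this
    rwa [← hφ]
  by_contra! hge
  have hhigh : pihat p ≤ m lam := by
    obtain ⟨-, -, hle⟩ := hmax lam
    refine le_trans ?_ (hle (θ 0))
    have := phase_unique h.hasDerivAt_abs_rpow h.continuous_abs_rpow_deriv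
      (intervalIntegrable_phaseCoeff hq p κ lam) (hΘ lam (θ 0)) hθ (hΘ0 _ _) 1
    simp only [hA, this]
    exact hge
  have hneg : -κ ^ p ≤ lam := by
    have := Real.rpow_pos_of_pos hκ p
    linarith
  obtain ⟨μ, hμ, hμT⟩ := intermediate_value_Icc hneg hmc.continuousOn ⟨hlow.le, hhigh⟩
  obtain ⟨φ, hφ, hle⟩ := hmax μ
  have hbal := h.integral_eq_zero_of_forall_phase_le (φ₀ := φ)
    (intervalIntegrable_phaseCoeff hq p κ μ) (hΘ0 μ) (hΘ μ)
    (fun t ht => (hcont t ht).comp (Continuous.prodMk_right μ)) fun ψ => (hle ψ).trans_eq hφ.symm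
  have hadv : Θ μ φ 1 = Θ μ φ 0 + pihat p := by
    rw [hΘ0]; rw [hμT] at hφ; linarith [show Θ μ φ 1 - φ = pihat p from hφ]
  have := hleast μ (h.isAntiPeriodicEig_of_phase hκ hq (hΘ μ φ) hadv hbal)
  linarith [hμ.2]

end GenSine

/-! ### Picone's identity -/

/-- The defect in the tangent inequality for the convex function `|·|^p`. -/
noncomputable def tangentGap (p a c : ℝ) : ℝ :=
  |a| ^ p + (p - 1) * |c| ^ p - p * a * sgnPow (p - 1) c

theorem continuous_tangentGap {p : ℝ} (hp : 1 < p) :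
    Continuous fun z : ℝ × ℝ => tangentGap p z.1 z.2 := by
  have h1 := continuous_abs_rpow (p := p) (by linarith)
  have h2 := continuous_sgnPow (r := p - 1) (by linarith)
  exact ((h1.comp continuous_fst).add (continuous_const.mul (h1.comp continuous_snd))).sub
    ((continuous_const.mul continuous_fst).mul (h2.comp continuous_snd))

namespace GenSine

variable {p : ℝ} {S C : ℝ → ℝ}

/-- A phase can cross a zero of the generalized sine only upwards. -/
theorem lt_phase_of_le (h : GenSine p S C) {q θ : ℝ → ℝ} {κ lam c s t : ℝ} (hκ : 0 < κ)
    (hq : ∀ x y, IntervalIntegrable q volume x y)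
    (hθ : ACDeriv θ fun t => κ + phaseCoeff p q κ lam t * |S (θ t)| ^ p)
    (hc : S c = 0) (hst : s < t) (hcs : c ≤ θ s) : c < θ t := by
  set G' : ℝ → ℝ := fun x => p * (sgnPow (p - 1) (S x) * C x)
  set a : ℝ → ℝ := fun t => phaseCoeff p q κ lam t * avgDeriv G' (θ t) c
  have ha : ∀ x y, IntervalIntegrable a volume x y :=
    intervalIntegrable_mul_avgDeriv h.continuous_abs_rpow_deriv
      (intervalIntegrable_phaseCoeff hq p κ lam) hθ.continuous continuous_const
  have hd : ACDeriv (fun t => θ t - c) fun t => a t * (θ t - c) + κ :=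
    (hθ.sub (.const c)).congr (fun _ => rfl) fun t => by
      have := sub_eq_avgDeriv_mul h.hasDerivAt_abs_rpow h.continuous_abs_rpow_deriv (θ t) c
      rw [hc, abs_zero, Real.zero_rpow h.pos.ne', sub_zero] at this
      rw [this]; ring
  have hsol := fun t => hd.linear_eq ha t
  have hAc := (ACDeriv.integral ha 0).continuous
  set J : ℝ → ℝ := fun s => Real.exp (-∫ x in (0:ℝ)..s, a x) * κ
  have hJ : Continuous J := (Real.continuous_exp.comp hAc.neg).mul continuous_const
  have hJpos : ∀ s, 0 < J s := fun s => mul_pos (Real.exp_pos _) hκ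
  have hlt : ∫ x in (0:ℝ)..s, J x < ∫ x in (0:ℝ)..t, J x := by
    rw [← sub_pos, intervalIntegral.integral_interval_sub_left (hJ.intervalIntegrable _ _)
      (hJ.intervalIntegrable _ _)]
    exact intervalIntegral.intervalIntegral_pos_of_pos (hJ.intervalIntegrable _ _) hJpos hst
  have h1 : 0 ≤ θ 0 - c + ∫ x in (0:ℝ)..s, J x := by
    have := hsol s
    refine nonneg_of_mul_nonneg_right (a := Real.exp (∫ x in (0:ℝ)..s, a x)) ?_ (Real.exp_pos _)
    rw [← this]; linarith
  have h2 := hsol t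
  rw [← sub_pos, h2]
  exact mul_pos (Real.exp_pos _) (by linarith)

/-- The generalized cotangent `(S'/S)^{(p-1)}`. -/
theorem hasDerivAt_conj_div (h : GenSine p S C) {x : ℝ} (hx : 0 < S x) :
    HasDerivAt (fun x => sgnPow (p - 1) (C x) / S x ^ (p - 1)) (-((p - 1) / |S x| ^ p)) x := by
  have hpow : HasDerivAt (fun x => S x ^ (p - 1)) (C x * (p - 1) * S x ^ (p - 1 - 1)) x :=
    (h.hasDerivAt x).rpow_const (Or.inl hx.ne')
  refine ((h.hasDerivAt_sgnPow x).div hpow (Real.rpow_pos_of_pos hx _).ne').congr_deriv ?_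
  have h1 := self_mul_sgnPow h.pos.ne' (C x)
  have h2 := h.pythagoras x
  rw [abs_of_pos hx] at h2 ⊢
  have e1 : S x ^ p = S x ^ (p - 1 - 1) * S x * S x := by
    rw [← Real.rpow_add_one hx.ne', ← Real.rpow_add_one hx.ne']; ring_nf
  have e2 : S x ^ (p - 1) = S x ^ (p - 1 - 1) * S x := by
    rw [← Real.rpow_add_one hx.ne']; ring_nf
  rw [sgnPow_of_pos _ hx, e2]
  rw [e1] at h2 ⊢
  have h3 : S x ^ (p - 1 - 1) ≠ 0 := (Real.rpow_pos_of_pos hx _).ne'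
  have h4 := hx.ne'
  field_simp
  rw [← h1] at h2
  linear_combination (1 - p) * h2

theorem map_pihat (h : GenSine p S C) : S (pihat p) = 0 := by
  obtain ⟨-, hshift, -, -, -⟩ := h.pihat_spec
  have := (hshift 0).1
  rwa [zero_add, h.map_zero, neg_zero] at this

theorem hasDerivAt_mul_conj_pihat (h : GenSine p S C) (t : ℝ) :
    HasDerivAt (fun t => S (pihat p * t) * sgnPow (p - 1) (C (pihat p * t)))
      (pihat p * (1 - p * |S (pihat p * t)| ^ p)) t :=
  ((h.hasDerivAt_mul_conj (pihat p * t)).comp t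
    ((hasDerivAt_id t).const_mul (pihat p))).congr_deriv (by ring)

theorem continuous_abs_rpow_pihat (h : GenSine p S C) :
    Continuous fun t => |S (pihat p * t)| ^ p :=
  h.continuous_abs_rpow.comp (continuous_const.mul continuous_id)

theorem integral_abs_rpow_pihat (h : GenSine p S C) :
    ∫ t in (0:ℝ)..1, |S (pihat p * t)| ^ p = 1 / p := by
  have hT := h.pihat_spec.1
  have hc := h.continuous_abs_rpow_pihat
  have h1 := intervalIntegral.integral_eq_sub_of_hasDerivAt (a := 0) (b := 1)
    (fun t _ => h.hasDerivAt_mul_conj_pihat t)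
    ((continuous_const.mul (continuous_const.sub (continuous_const.mul hc))).intervalIntegrable 0 1)
  rw [intervalIntegral.integral_const_mul, intervalIntegral.integral_sub intervalIntegrable_const
    ((hc.intervalIntegrable 0 1).const_mul p), intervalIntegral.integral_const_mul] at h1
  simp only [mul_one, mul_zero, h.map_pihat, h.map_zero, zero_mul, sub_zero,
    intervalIntegral.integral_const, smul_eq_mul, mul_eq_zero, hT.ne', false_or] at h1
  rw [eq_div_iff h.pos.ne']
  linarith

theorem tangentGap_phase (h : GenSine p S C) {κ x y : ℝ} (hκ : 0 < κ) (hx : 0 < S x) :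
    tangentGap p (pihat p * C y) (κ * S y * (C x / S x)) =
      pihat p ^ p * (1 - |S y| ^ p) + (p - 1) * (κ ^ p * |S y| ^ p * (1 / |S x| ^ p - 1)) -
        p * (pihat p * C y) * (κ ^ (p - 1) * sgnPow (p - 1) (S y) *
          (sgnPow (p - 1) (C x) / S x ^ (p - 1))) := by
  have hT := h.pihat_spec.1
  have h1 : |C y| ^ p = 1 - |S y| ^ p := by rw [← h.pythagoras y]; ring
  have h2 : |C x| ^ p = 1 - |S x| ^ p := by rw [← h.pythagoras x]; ring
  have h3 : |S x| ^ p ≠ 0 := (Real.rpow_pos_of_pos (abs_pos.2 hx.ne') p).ne'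
  have h4 : sgnPow (p - 1) (C x / S x) = sgnPow (p - 1) (C x) / S x ^ (p - 1) := by
    rw [div_eq_mul_inv, sgnPow_mul, sgnPow_of_pos _ (inv_pos.2 hx), Real.inv_rpow hx.le,
      ← div_eq_mul_inv]
  rw [tangentGap, sgnPow_mul, sgnPow_mul, h4, sgnPow_of_pos _ hκ, abs_mul, abs_mul, abs_mul,
    abs_div, abs_of_pos hT, abs_of_pos hκ, Real.mul_rpow hT.le (abs_nonneg _),
    Real.mul_rpow (by positivity) (by positivity), Real.mul_rpow hκ.le (abs_nonneg _),
    Real.div_rpow (abs_nonneg _) (abs_nonneg _), h1, h2]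
  field_simp

/-- Picone's identity, integrated over the unit interval. -/
theorem integral_tangentGap (h : GenSine p S C) {q θ : ℝ → ℝ} {κ lam : ℝ} (hκ : 0 < κ)
    (hq : ∀ x y, IntervalIntegrable q volume x y)
    (hθ : ACDeriv θ fun t => κ + phaseCoeff p q κ lam t * |S (θ t)| ^ p)
    (hmem : ∀ t ∈ Icc (0:ℝ) 1, θ t ∈ Ioo 0 (pihat p))
    (hqG : ∫ t in (0:ℝ)..1, q t * |S (pihat p * t)| ^ p = 0) :
    ∫ t in (0:ℝ)..1, tangentGap p (pihat p * C (pihat p * t))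
      (κ * S (pihat p * t) * (C (θ t) / S (θ t))) = (p - 1) / p * (pihat p ^ p - lam) := by
  obtain ⟨hT, -, hSpos, -, -⟩ := h.pihat_spec
  have hp := h.pos
  set F : ℝ → ℝ := fun x => sgnPow (p - 1) (C x) / S x ^ (p - 1) with hF
  have hFac : AbsolutelyContinuousOnInterval (fun t => F (θ t)) 0 1 := by
    refine (hθ.ac 0 1).comp_of_continuousOn_deriv (U := Ioo 0 (pihat p))
      (fun x hx => h.hasDerivAt_conj_div (hSpos x hx)) ?_ ?_
    · exact (continuousOn_const.div h.continuous_abs_rpow.continuousOn fun x hx =>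
        (Real.rpow_pos_of_pos (abs_pos.2 (hSpos x hx).ne') p).ne').neg
    · rw [uIcc_of_le zero_le_one]; exact hmem
  have hGd : ∀ t, HasDerivAt (fun t => |S (pihat p * t)| ^ p)
      (pihat p * (p * (sgnPow (p - 1) (S (pihat p * t)) * C (pihat p * t)))) t := fun t =>
    ((h.hasDerivAt_abs_rpow (pihat p * t)).comp t
      ((hasDerivAt_id t).const_mul (pihat p))).congr_deriv (by ring)
  have hGac := ACDeriv.of_hasDerivAt hGd
    (continuous_const.mul (h.continuous_abs_rpow_deriv.comp (by fun_prop)))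
  have hVac := (hGac.ac 0 1).fun_mul hFac
  have hκ1 := rpow_sub_one_mul_rpow_one_sub hκ p
  have hκp : κ ^ (p - 1) * κ = κ ^ p := by rw [← Real.rpow_add_one hκ.ne']; ring_nf
  have key : ∀ᵐ t : ℝ, t ∈ uIoc (0:ℝ) 1 → tangentGap p (pihat p * C (pihat p * t))
      (κ * S (pihat p * t) * (C (θ t) / S (θ t))) =
        pihat p ^ p - κ ^ (p - 1) * deriv (fun t => |S (pihat p * t)| ^ p * F (θ t)) t -
          ((pihat p ^ p + (p - 1) * lam) * |S (pihat p * t)| ^ p -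
            (p - 1) * (q t * |S (pihat p * t)| ^ p)) := by
    filter_upwards [hθ.ae_deriv] with t ht hmt
    rw [uIoc_of_le zero_le_one] at hmt
    have hx := hSpos _ (hmem t ⟨hmt.1.le, hmt.2⟩)
    have h3 : |S (θ t)| ^ p ≠ 0 := (Real.rpow_pos_of_pos (abs_pos.2 hx.ne') p).ne'
    have hd := ((hGd t).mul ((h.hasDerivAt_conj_div hx).comp t ht)).deriv
    have hd' : deriv (fun t => |S (pihat p * t)| ^ p * F (θ t)) t = _ := hd
    rw [hd', h.tangentGap_phase hκ hx, Function.comp_apply, phaseCoeff]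
    have h4 : -((p - 1) / |S (θ t)| ^ p) *
        (κ + (κ ^ (1 - p) * (lam - q t) - κ) * |S (θ t)| ^ p) =
        -(p - 1) * (κ * (1 / |S (θ t)| ^ p) + κ ^ (1 - p) * (lam - q t) - κ) := by
      field_simp
      ring
    rw [h4]
    linear_combination (p - 1) * |S (pihat p * t)| ^ p * ((1 - 1 / |S (θ t)| ^ p) * hκp -
      (lam - q t) * hκ1)
  have hVi : IntervalIntegrable (fun t => κ ^ (p - 1) *
      deriv (fun t => |S (pihat p * t)| ^ p * F (θ t)) t) volume 0 1 :=
    hVac.intervalIntegrable_deriv.const_mul _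
  have hGi := h.continuous_abs_rpow_pihat.intervalIntegrable (μ := volume) 0 1
  have hqGi := (hq 0 1).mul_continuousOn h.continuous_abs_rpow_pihat.continuousOn
  rw [intervalIntegral.integral_congr_ae key, intervalIntegral.integral_sub
    (intervalIntegrable_const.sub hVi) ((hGi.const_mul _).sub (hqGi.const_mul _)),
    intervalIntegral.integral_sub intervalIntegrable_const hVi,
    intervalIntegral.integral_sub (hGi.const_mul _) (hqGi.const_mul _),
    intervalIntegral.integral_const_mul, intervalIntegral.integral_const_mul,
    intervalIntegral.integral_const_mul, hqG, h.integral_abs_rpow_pihat,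
    hVac.integral_deriv_eq_sub]
  simp only [mul_one, mul_zero, h.map_pihat, h.map_zero, abs_zero, Real.zero_rpow hp.ne', zero_mul,
    sub_zero, intervalIntegral.integral_const, smul_eq_mul]
  field_simp
  ring

end GenSine

/-! ### The rigidity argument -/

namespace GenSine

variable {p : ℝ} {S C : ℝ → ℝ}

/-- If the logarithmic derivatives of `S ∘ θ` and `S (π̂ ·)` agree, the potential vanishes. -/
theorem ae_eq_zero_of_eqOn (h : GenSine p S C) {q θ : ℝ → ℝ} {κ : ℝ} (hκ : 0 < κ)
    (hθ : ACDeriv θ fun t => κ + phaseCoeff p q κ (pihat p ^ p) t * |S (θ t)| ^ p)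
    (hmem : ∀ t ∈ Ioo (0:ℝ) 1, θ t ∈ Ioo 0 (pihat p))
    (heq : ∀ t ∈ Ioo (0:ℝ) 1,
      pihat p * C (pihat p * t) = κ * S (pihat p * t) * (C (θ t) / S (θ t))) :
    ∀ᵐ t : ℝ, t ∈ Ioo (0:ℝ) 1 → q t = 0 := by
  obtain ⟨hT, -, hSpos, -, -⟩ := h.pihat_spec
  have hp := h.pos
  have hp1 := h.sub_one_pos
  have hψ : ∀ t ∈ Ioo (0:ℝ) 1, 0 < S (pihat p * t) := fun t ht =>
    hSpos _ ⟨mul_pos hT ht.1, mul_lt_of_lt_one_right hT ht.2⟩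
  set F : ℝ → ℝ := fun x => sgnPow (p - 1) (C x) / S x ^ (p - 1) with hF
  have hFF : ∀ t ∈ Ioo (0:ℝ) 1,
      pihat p ^ (p - 1) * F (pihat p * t) = κ ^ (p - 1) * F (θ t) := fun t ht => by
    have hx := hSpos _ (hmem t ht)
    have hy := hψ t ht
    have h1 := congrArg (sgnPow (p - 1)) (heq t ht)
    rw [div_eq_mul_inv, sgnPow_mul, sgnPow_mul, sgnPow_mul, sgnPow_mul, sgnPow_of_pos _ hκ,
      sgnPow_of_pos _ hT, sgnPow_of_pos _ hy, sgnPow_of_pos _ (inv_pos.2 hx),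
      Real.inv_rpow hx.le] at h1
    have h2 := (Real.rpow_pos_of_pos hy (p - 1)).ne'
    simp only [hF, div_eq_mul_inv]
    rw [← mul_assoc, h1]
    field_simp
  filter_upwards [hθ.ae_deriv] with t ht htm
  have hx := hSpos _ (hmem t htm)
  have hy := hψ t htm
  have hGx : |S (θ t)| ^ p ≠ 0 := (Real.rpow_pos_of_pos (abs_pos.2 hx.ne') p).ne'
  have hGy : |S (pihat p * t)| ^ p ≠ 0 := (Real.rpow_pos_of_pos (abs_pos.2 hy.ne') p).ne'
  have hd1 := (((h.hasDerivAt_conj_div hy).comp t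
    ((hasDerivAt_id t).const_mul (pihat p)))).const_mul (pihat p ^ (p - 1))
  have hd2 := ((h.hasDerivAt_conj_div hx).comp t ht).const_mul (κ ^ (p - 1))
  have hd := hd1.unique (hd2.congr_of_eventuallyEq
    ((Ioo_mem_nhds htm.1 htm.2 : Ioo (0:ℝ) 1 ∈ 𝓝 t) |> eventually_of_mem <| hFF))
  have habs := congrArg (fun x => |x| ^ p) (heq t htm)
  simp only [abs_mul, abs_div, abs_of_pos hT, abs_of_pos hκ] at habs
  rw [Real.mul_rpow hT.le (abs_nonneg _), Real.mul_rpow (by positivity) (by positivity),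
    Real.mul_rpow hκ.le (abs_nonneg _), Real.div_rpow (abs_nonneg _) (abs_nonneg _)] at habs
  have e1 : |C (pihat p * t)| ^ p = 1 - |S (pihat p * t)| ^ p := by
    rw [← h.pythagoras (pihat p * t)]; ring
  have e2 : |C (θ t)| ^ p = 1 - |S (θ t)| ^ p := by rw [← h.pythagoras (θ t)]; ring
  rw [e1, e2] at habs
  have hκ1 := rpow_sub_one_mul_rpow_one_sub hκ p
  have hκp : κ ^ (p - 1) * κ = κ ^ p := by rw [← Real.rpow_add_one hκ.ne']; ring_nf
  have hTp : pihat p ^ (p - 1) * pihat p = pihat p ^ p := by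
    rw [← Real.rpow_add_one hT.ne']; ring_nf
  rw [phaseCoeff] at hd
  set X := |S (θ t)| ^ p
  set Y := |S (pihat p * t)| ^ p
  have hd' : pihat p ^ (p - 1) * pihat p / Y = κ ^ (p - 1) * κ / X +
      κ ^ (p - 1) * κ ^ (1 - p) * (pihat p ^ p - q t) - κ ^ (p - 1) * κ := by
    have h3 := hp1.ne'
    field_simp at hd ⊢
    linear_combination -hd
  rw [hκ1, hκp, hTp] at hd'
  have habs' : pihat p ^ p / Y - pihat p ^ p = κ ^ p / X - κ ^ p := by
    field_simp at habs ⊢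
    linear_combination habs
  linarith

theorem ae_eq_zero_of_forall_le (h : GenSine p S C) {q : ℝ → ℝ}
    (hq : ∀ x y, IntervalIntegrable q volume x y)
    (hleast : ∀ lam : ℝ, IsAntiPeriodicEig p q lam → pihat p ^ p ≤ lam)
    (hqG : ∫ t in (0:ℝ)..1, q t * |S (pihat p * t)| ^ p = 0) :
    ∀ᵐ t : ℝ, t ∈ Ioo (0:ℝ) 1 → q t = 0 := by
  obtain ⟨hT, -, hSpos, -, -⟩ := h.pihat_spec
  have hp := h.pos
  obtain ⟨κ, hsmall, hκ⟩ := (((h.tendsto_rpow_one_sub (∫ t in (0:ℝ)..1, |q t|)).eventually_lt_const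
    h.integral_bump_pos).and (eventually_gt_atTop 0)).exists
  choose Θ hΘ0 hΘ using fun lam φ => h.exists_phase hq κ lam φ
  have hcont : ∀ t ∈ Icc (0:ℝ) 1, Continuous fun z : ℝ × ℝ => Θ z.1 z.2 t := fun t ht =>
    h.continuous_phase hq hΘ0 hΘ ht
  have hTp : 0 < pihat p ^ p := Real.rpow_pos_of_pos hT p
  set lam : ℕ → ℝ := fun j => pihat p ^ p * (1 - 1 / ((j:ℝ) + 1)) with hlam
  have hj : ∀ j : ℕ, 0 < 1 / ((j:ℝ) + 1) := fun j => Nat.one_div_pos_of_nat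
  have hlam0 : ∀ j, 0 ≤ lam j := fun j => by
    have : 1 / ((j:ℝ) + 1) ≤ 1 := (div_le_one (by positivity)).2 (by simp)
    exact mul_nonneg hTp.le (by linarith)
  have hlam1 : ∀ j, lam j < pihat p ^ p := fun j =>
    mul_lt_of_lt_one_right hTp (by linarith [hj j])
  have hlamt : Tendsto lam atTop (𝓝 (pihat p ^ p)) := by
    have h1 := ((tendsto_one_div_add_atTop_nhds_zero_nat (𝕜 := ℝ)).const_sub 1).const_mul
      (pihat p ^ p)
    rw [sub_zero, mul_one] at h1
    exact h1
  have hφ : ∀ j : ℕ, ∃ φ ∈ Ioo 0 (1 / ((j:ℝ) + 1)), Θ (lam j) φ 1 < pihat p := fun j => by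
    have h1 := h.phase_sub_lt_of_forall_le hq hκ hsmall hleast (hlam0 j) (hlam1 j) (hΘ (lam j) 0)
    rw [hΘ0, sub_zero] at h1
    have h2 : Continuous fun φ => Θ (lam j) φ 1 :=
      (hcont 1 (by simp)).comp (Continuous.prodMk_right (lam j))
    obtain ⟨φ, h3, h4⟩ := (((h2.tendsto 0).mono_left
      (nhdsWithin_le_nhds (s := Ioi 0))).eventually_lt_const h1 |>.and
        (Ioo_mem_nhdsGT (hj j))).exists
    exact ⟨φ, h4, h3⟩
  choose φ hφ hφ1 using hφ
  have hφt : Tendsto φ atTop (𝓝 0) :=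
    squeeze_zero (fun j => (hφ j).1.le) (fun j => (hφ j).2.le)
      tendsto_one_div_add_atTop_nhds_zero_nat
  have hΘt : ∀ t ∈ Icc (0:ℝ) 1, Tendsto (fun j => Θ (lam j) (φ j) t) atTop
      (𝓝 (Θ (pihat p ^ p) 0 t)) := fun t ht =>
    ((hcont t ht).tendsto (pihat p ^ p, 0)).comp (hlamt.prodMk_nhds hφt)
  have hmem : ∀ j, ∀ t ∈ Icc (0:ℝ) 1, Θ (lam j) (φ j) t ∈ Ioo 0 (pihat p) := fun j t ht => by
    constructor
    · rcases ht.1.eq_or_lt with rfl | h0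
      · rw [hΘ0]; exact (hφ j).1
      · exact h.lt_phase_of_le hκ hq (hΘ _ _) h.map_zero h0 (by rw [hΘ0]; exact (hφ j).1.le)
    · rcases ht.2.eq_or_lt with rfl | h1
      · exact hφ1 j
      · by_contra! hge
        exact (hφ1 j).not_gt (h.lt_phase_of_le hκ hq (hΘ _ _) h.map_pihat h1 hge)
  set θ := Θ (pihat p ^ p) 0 with hθdef
  have hθmem : ∀ t ∈ Ioo (0:ℝ) 1, θ t ∈ Ioo 0 (pihat p) := fun t ht => by
    constructor
    · exact h.lt_phase_of_le hκ hq (hΘ _ _) h.map_zero ht.1 (hΘ0 _ _).ge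
    · by_contra! hge
      have h1 := h.lt_phase_of_le hκ hq (hΘ _ _) h.map_pihat ht.2 hge
      exact h1.not_ge (le_of_tendsto' (hΘt 1 (by simp)) fun j => (hφ1 j).le)
  set c : (ℝ → ℝ) → ℝ → ℝ := fun ϑ t => κ * S (pihat p * t) * (C (ϑ t) / S (ϑ t)) with hc
  set a : ℝ → ℝ := fun t => pihat p * C (pihat p * t) with ha
  have hac : Continuous a := continuous_const.mul (h.continuous_deriv.comp (by fun_prop))
  have hgap := continuous_tangentGap h.one_lt
  have hgap0 : ∀ x y, 0 ≤ tangentGap p x y := fun x y => (abs_rpow_tangent h.one_lt x y).1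
  have hmeas : ∀ j, Measurable fun t => ENNReal.ofReal
      (tangentGap p (a t) (c (Θ (lam j) (φ j)) t)) := fun j => by
    have h1 := h.continuous.comp (hΘ (lam j) (φ j)).continuous
    have h2 := h.continuous_deriv.comp (hΘ (lam j) (φ j)).continuous
    have h3 : Measurable (c (Θ (lam j) (φ j))) :=
      (continuous_const.mul (h.continuous.comp (continuous_const.mul continuous_id))).measurable.mul
        (h2.measurable.div h1.measurable)
    exact (hgap.measurable.comp (hac.measurable.prodMk h3)).ennreal_ofReal
  have h_int : ∀ j, ∫⁻ t in Ioo (0:ℝ) 1, ENNReal.ofReal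
      (tangentGap p (a t) (c (Θ (lam j) (φ j)) t)) =
        ENNReal.ofReal ((p - 1) / p * (pihat p ^ p - lam j)) := fun j => by
    have h1 : ContinuousOn (c (Θ (lam j) (φ j))) (Icc 0 1) :=
      (continuous_const.mul
        (h.continuous.comp (continuous_const.mul continuous_id))).continuousOn.mul
        ((h.continuous_deriv.comp (hΘ (lam j) (φ j)).continuous).continuousOn.div
          (h.continuous.comp (hΘ (lam j) (φ j)).continuous).continuousOn
          fun t ht => (hSpos _ (hmem j t ht)).ne')
    have h2 : IntegrableOn (fun t => tangentGap p (a t) (c (Θ (lam j) (φ j)) t)) (Icc 0 1) :=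
      (hgap.comp_continuousOn (hac.continuousOn.prodMk h1)).integrableOn_compact isCompact_Icc
    rw [← h.integral_tangentGap hκ hq (hΘ (lam j) (φ j)) (hmem j) hqG,
      intervalIntegral.integral_of_le zero_le_one, integral_Ioc_eq_integral_Ioo,
      ofReal_integral_eq_lintegral_ofReal (h2.mono_set Ioo_subset_Icc_self)
        (ae_of_all _ fun t => hgap0 _ _)]
  have hlim : Tendsto (fun j => ENNReal.ofReal ((p - 1) / p * (pihat p ^ p - lam j))) atTop
      (𝓝 0) := by
    simpa using ENNReal.tendsto_ofReal ((hlamt.const_sub (pihat p ^ p)).const_mul ((p - 1) / p))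
  have hpt : ∀ t ∈ Ioo (0:ℝ) 1, Tendsto (fun j => ENNReal.ofReal
      (tangentGap p (a t) (c (Θ (lam j) (φ j)) t))) atTop
        (𝓝 (ENNReal.ofReal (tangentGap p (a t) (c θ t)))) := fun t ht => by
    have h1 := hΘt t ⟨ht.1.le, ht.2.le⟩
    have h2 : Tendsto (fun j => c (Θ (lam j) (φ j)) t) atTop (𝓝 (c θ t)) := by
      have h3 := (h.continuous_deriv.tendsto (θ t)).comp h1
      have h4 := (h.continuous.tendsto (θ t)).comp h1
      exact (h3.div h4 (hSpos _ (hθmem t ht)).ne').const_mul (κ * S (pihat p * t))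
    have h5 := (hgap.tendsto (a t, c θ t)).comp (tendsto_const_nhds.prodMk_nhds h2)
    exact ENNReal.tendsto_ofReal h5
  have hzero : ∫⁻ t in Ioo (0:ℝ) 1, ENNReal.ofReal (tangentGap p (a t) (c θ t)) = 0 := by
    have h1 := lintegral_liminf_le (u := atTop)
      (μ := volume.restrict (Ioo (0:ℝ) 1)) hmeas
    simp only [h_int, hlim.liminf_eq] at h1
    rw [← nonpos_iff_eq_zero]
    refine le_trans (le_of_eq ?_) h1
    exact setLIntegral_congr_fun measurableSet_Ioo fun t ht => (hpt t ht).liminf_eq.symm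
  have hcθ : ContinuousOn (c θ) (Ioo 0 1) :=
    (continuous_const.mul (h.continuous.comp (continuous_const.mul continuous_id))).continuousOn.mul
      ((h.continuous_deriv.comp (hΘ _ _).continuous).continuousOn.div
        (h.continuous.comp (hΘ _ _).continuous).continuousOn
        fun t ht => (hSpos _ (hθmem t ht)).ne')
  have hcm : AEMeasurable (fun t => ENNReal.ofReal (tangentGap p (a t) (c θ t)))
      (volume.restrict (Ioo (0:ℝ) 1)) :=
    ((hgap.comp_continuousOn (hac.continuousOn.prodMk hcθ)).aemeasurable
      measurableSet_Ioo).ennreal_ofReal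
  have hae : a =ᵐ[volume.restrict (Ioo (0:ℝ) 1)] c θ := by
    filter_upwards [(lintegral_eq_zero_iff' hcm).1 hzero] with t ht
    refine (abs_rpow_tangent h.one_lt _ _).2 (le_antisymm ?_ (hgap0 _ _))
    exact ENNReal.ofReal_eq_zero.1 ht
  exact h.ae_eq_zero_of_eqOn hκ (hΘ _ _) hθmem
    (Measure.eqOn_open_of_ae_eq hae isOpen_Ioo hac.continuousOn hcθ)

end GenSine

/-- Ambarzumyan theorem for the anti-periodic `p`-Laplacian. -/
theorem ambarzumyan_antiperiodic (p : ℝ) (hp : 1 < p)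
    (S : ℝ → ℝ) (hSdiff : Differentiable ℝ S)
    (hS0 : S 0 = 0) (hS'0 : deriv S 0 = 1)
    (hSprod : ∀ x : ℝ, HasDerivAt (fun t => S t * sgnPow (p - 1) (deriv S t))
      (1 - p * |S x| ^ p) x)
    (hpyth : ∀ x : ℝ, |S x| ^ p + |deriv S x| ^ p = 1)
    (hSper : ∀ x : ℝ, S (x + 2 * pihat p) = S x)
    (q : ℝ → ℝ) (hqper : ∀ x, q (x + 1) = q x) (hq : IntegrableOn q (Set.Icc 0 1))
    (hspec : ∀ n : ℕ, 1 ≤ n → IsAntiPeriodicEig p q (((2 * n - 1) * pihat p) ^ p))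
    (hleast0 : IsAntiPeriodicEig p q ((pihat p) ^ p))
    (hleast : ∀ lam : ℝ, IsAntiPeriodicEig p q lam → (pihat p) ^ p ≤ lam)
    (horth : ∫ t in Set.Ioo (0:ℝ) 1,
      q t * deriv (fun s => S (pihat p * s) * sgnPow (p - 1) (deriv S (pihat p * s))) t = 0) :
    ∀ᵐ x ∂(volume.restrict (Set.Icc (0:ℝ) 1)), q x = 0 := by
  have h := GenSine.of_hasDerivAt_mul hp hSdiff hS0 hS'0 hSprod hpyth
  have hqi : ∀ x y, IntervalIntegrable q volume x y :=
    Function.Periodic.intervalIntegrable₀ (T := 1) hqper one_ne_zero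
      ((intervalIntegrable_iff_integrableOn_Icc_of_le zero_le_one).2 hq)
  have hmean := h.integral_eq_zero hqi hspec
  have hqG : ∫ t in (0:ℝ)..1, q t * |S (pihat p * t)| ^ p = 0 := by
    simp_rw [(h.hasDerivAt_mul_conj_pihat _).deriv] at horth
    rw [← integral_Ioc_eq_integral_Ioo, ← intervalIntegral.integral_of_le zero_le_one] at horth
    have hi := (hqi 0 1).mul_continuousOn h.continuous_abs_rpow_pihat.continuousOn
    have h1 : ∀ t, q t * (pihat p * (1 - p * |S (pihat p * t)| ^ p)) =
        pihat p * q t - pihat p * p * (q t * |S (pihat p * t)| ^ p) := fun t => by ring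
    simp_rw [h1] at horth
    rw [intervalIntegral.integral_sub ((hqi 0 1).const_mul _) (hi.const_mul _),
      intervalIntegral.integral_const_mul, intervalIntegral.integral_const_mul, hmean, mul_zero,
      zero_sub, neg_eq_zero] at horth
    exact (mul_eq_zero.1 horth).resolve_left (mul_pos h.pihat_spec.1 h.pos).ne'
  rw [← Measure.restrict_congr_set Ioo_ae_eq_Icc, ae_restrict_iff' measurableSet_Ioo]
  exact h.ae_eq_zero_of_forall_le hqi hleast hqG
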